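/- arXiv:1605.04840 — 4 statements merged into one kernel-verified Lean document; each statement's English description precedes it below -/
import Mathlib

section
/- Let μ be an even probability measure on ℝ with density e^{−V}, where e^{−V} ∈ C²(ℝ) is everywhere positive, and with ∫_ℝ |t|⁵ dμ(t) < ∞. Let Φ(s) = μ((−∞, s]) and, for a, b > 0, define H_{a,b}(x,y) = Φ(a Φ^{−1}(x) + b Φ^{−1}(y)) on [0,1]² \ {(0,1),(1,0)} with H_{a,b}(0,1) = H_{a,b}(1,0) = 0. Then there exist a, b > 0 such that H_{a,b} satisfies inequality (★) for μ with n = 1 (for all Borel measurable (f,g) : ℝ × ℝ → [0,1]²) if and only if μ is a centered Gaussian measure, i.e. its density is e^{−cx² + d} for some c > 0 and d ∈ ℝ. -/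
open MeasureTheory Real Filter

noncomputable section

/-- Inequality (★) in dimension `n = 1`. -/
def StarIneq1 (a b : ℝ) (Ω : Set (ℝ × ℝ)) (H : ℝ × ℝ → ℝ) (μ : Measure ℝ) : Prop :=
  ∀ f g : ℝ → ℝ, Measurable f → Measurable g →
    (∀ x y, (f x, g y) ∈ Ω) →
    H (∫ x, f x ∂μ, ∫ x, g x ∂μ) ≤
      ∫ x, essSup (fun y => H (f ((x - y) / a), g (y / b))) volume ∂μ

open scoped Topology NNReal ENNReal

/-- `Φ` is a distribution function with positive density `p`, and `Ψ` is its quantile function. -/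
structure IsQuantilePair (p Φ Ψ : ℝ → ℝ) : Prop where
  hasDerivAt : ∀ s, HasDerivAt Φ (p s) s
  pos : ∀ s, 0 < p s
  mem : ∀ s, Φ s ∈ Set.Ioo (0 : ℝ) 1
  apply_quantile : ∀ x ∈ Set.Ioo (0 : ℝ) 1, Φ (Ψ x) = x

namespace IsQuantilePair

variable {p Φ Ψ : ℝ → ℝ}

theorem strictMono (h : IsQuantilePair p Φ Ψ) : StrictMono Φ :=
  strictMono_of_deriv_pos fun s => by rw [(h.hasDerivAt s).deriv]; exact h.pos s

theorem continuous (h : IsQuantilePair p Φ Ψ) : Continuous Φ :=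
  continuous_iff_continuousAt.2 fun s => (h.hasDerivAt s).continuousAt

theorem quantile_apply (h : IsQuantilePair p Φ Ψ) (s : ℝ) : Ψ (Φ s) = s :=
  h.strictMono.injective (h.apply_quantile _ (h.mem s))

theorem strictMonoOn_quantile (h : IsQuantilePair p Φ Ψ) :
    StrictMonoOn Ψ (Set.Ioo 0 1) := fun x hx y hy hxy => by
  rwa [← h.strictMono.lt_iff_lt, h.apply_quantile x hx, h.apply_quantile y hy]

theorem continuousAt_quantile (h : IsQuantilePair p Φ Ψ) {x : ℝ} (hx : x ∈ Set.Ioo (0 : ℝ) 1) :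
    ContinuousAt Ψ x := by
  refine h.strictMonoOn_quantile.continuousAt_of_image_mem_nhds (Ioo_mem_nhds hx.1 hx.2) ?_
  convert univ_mem
  ext s
  simpa using ⟨Φ s, h.mem s, h.quantile_apply s⟩

theorem hasDerivAt_quantile (h : IsQuantilePair p Φ Ψ) {x : ℝ} (hx : x ∈ Set.Ioo (0 : ℝ) 1) :
    HasDerivAt Ψ (p (Ψ x))⁻¹ x :=
  HasDerivAt.of_local_left_inverse (h.continuousAt_quantile hx) (h.hasDerivAt _) (h.pos _).ne'
    (by filter_upwards [Ioo_mem_nhds hx.1 hx.2] with y hy using h.apply_quantile y hy)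

theorem exists_lt_apply (h : IsQuantilePair p Φ Ψ) {c : ℝ} (hc : c < 1) : ∃ s, c < Φ s := by
  have hx : (max c 0 + 1) / 2 ∈ Set.Ioo (0 : ℝ) 1 := by
    constructor <;> cases max_cases c 0 <;> linarith
  exact ⟨Ψ ((max c 0 + 1) / 2), by
    rw [h.apply_quantile _ hx]; cases max_cases c 0 <;> linarith⟩

theorem exists_apply_lt (h : IsQuantilePair p Φ Ψ) {c : ℝ} (hc : 0 < c) : ∃ s, Φ s < c := by
  have hx : (min c 1) / 2 ∈ Set.Ioo (0 : ℝ) 1 := by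
    constructor <;> cases min_cases c 1 <;> linarith
  exact ⟨Ψ ((min c 1) / 2), by
    rw [h.apply_quantile _ hx]; cases min_cases c 1 <;> linarith⟩

end IsQuantilePair

/-- The distribution function of a probability measure with a continuous positive density. -/
theorem isQuantilePair_of_withDensity {p Φ Ψ : ℝ → ℝ} {μ : Measure ℝ} [IsProbabilityMeasure μ]
    (hp : Continuous p) (hpos : ∀ s, 0 < p s)
    (hμ : μ = volume.withDensity fun x => ENNReal.ofReal (p x))
    (hΦ : ∀ s, Φ s = (μ (Set.Iic s)).toReal)
    (hΨ : ∀ x ∈ Set.Ioo (0 : ℝ) 1, Φ (Ψ x) = x) : IsQuantilePair p Φ Ψ := by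
  have hint : Integrable p := by
    refine ⟨hp.aestronglyMeasurable, ?_⟩
    rw [hasFiniteIntegral_iff_ofReal (ae_of_all _ fun x => (hpos x).le)]
    have : μ Set.univ = 1 := measure_univ
    rw [hμ, withDensity_apply _ MeasurableSet.univ, Measure.restrict_univ] at this
    simp [this]
  have hΦ' : ∀ s, Φ s = ∫ x in Set.Iic s, p x := fun s => by
    rw [hΦ, hμ, withDensity_apply _ measurableSet_Iic,
      integral_eq_lintegral_of_nonneg_ae (ae_of_all _ fun x => (hpos x).le)
        hp.aestronglyMeasurable]
  have hd : ∀ s, HasDerivAt Φ (p s) s := fun s => by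
    have h1 : Φ = fun u => (∫ x in (0 : ℝ)..u, p x) + Φ 0 := by
      ext u
      rw [intervalIntegral.integral_Iic_sub_Iic hint.integrableOn hint.integrableOn |>.symm,
        hΦ', hΦ']
      ring
    rw [h1]
    exact (intervalIntegral.integral_hasDerivAt_right (hp.intervalIntegrable _ _)
      hp.stronglyMeasurable.stronglyMeasurableAtFilter hp.continuousAt).add_const _
  have hmono : StrictMono Φ :=
    strictMono_of_deriv_pos fun s => by rw [(hd s).deriv]; exact hpos s
  refine ⟨hd, hpos, fun s => ⟨?_, ?_⟩, hΨ⟩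
  · exact lt_of_le_of_lt (by rw [hΦ]; positivity) (hmono (sub_one_lt s))
  · refine lt_of_lt_of_le (hmono (lt_add_one s)) ?_
    rw [hΦ]
    exact ENNReal.toReal_le_of_le_ofReal zero_le_one (by simpa using prob_le_one)

/-- The second-order necessary condition at a minimum. -/
theorem second_deriv_nonneg_of_forall_le {φ φ₁ : ℝ → ℝ} {c : ℝ}
    (hφ : ∀ s, HasDerivAt φ (φ₁ s) s) (hφ₁ : HasDerivAt φ₁ c 0) (hmin : ∀ s, φ 0 ≤ φ s) :
    0 ≤ c := by
  by_contra! hc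
  have hd : deriv φ = φ₁ := funext fun s => (hφ s).deriv
  have hmin' : IsLocalMin φ 0 := Eventually.of_forall hmin
  have h0 : deriv φ 0 = 0 := hmin'.deriv_eq_zero
  have hmax : IsLocalMax φ 0 :=
    isLocalMax_of_deriv_deriv_neg (by rw [hd, hφ₁.deriv]; exact hc) h0 (hφ 0).continuousAt
  have hconst : φ =ᶠ[𝓝 0] fun _ => φ 0 := by
    filter_upwards [hmax] with s hs using le_antisymm hs (hmin s)
  have hz : deriv φ =ᶠ[𝓝 0] fun _ => 0 := by simpa using hconst.deriv
  rw [hd] at hz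
  exact hc.ne (hφ₁.unique ((hasDerivAt_const (0 : ℝ) (0 : ℝ)).congr_of_eventuallyEq hz))

/-- A spatially periodic solution on the time interval `[0, 1]` of
`∂ₜ F = (v / 2) ∂ₓₓ F - F (∂ₓ F)² / 2`, the equation satisfied by the Gaussian quantile of a
solution of the heat equation. -/
structure IsQuantileFlow (v T : ℝ) (F F₁ F₂ : ℝ → ℝ → ℝ) : Prop where
  continuousOn : ContinuousOn (Function.uncurry F) (Set.Icc 0 1 ×ˢ Set.univ)
  periodic : ∀ t, Function.Periodic (F t) T
  hasDerivAt : ∀ t > 0, ∀ x, HasDerivAt (F t) (F₁ t x) x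
  hasDerivAt_deriv : ∀ t > 0, ∀ x, HasDerivAt (F₁ t) (F₂ t x) x
  hasDerivAt_time : ∀ t > 0, ∀ x,
    HasDerivAt (fun s => F s x) (v / 2 * F₂ t x - F t x * F₁ t x ^ 2 / 2) t

/-- The parabolic maximum principle behind the Ehrhard inequality. -/
theorem IsQuantileFlow.add_le {v T : ℝ} (hv : 0 < v) (hT : 0 < T)
    {F F₁ F₂ G G₁ G₂ K K₁ K₂ : ℝ → ℝ → ℝ} (hF : IsQuantileFlow v T F F₁ F₂)
    (hG : IsQuantileFlow v T G G₁ G₂) (hK : IsQuantileFlow v T K K₁ K₂)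
    (h0 : ∀ x y, F 0 x + G 0 y ≤ K 0 (x + y)) {t : ℝ} (ht : t ∈ Set.Icc (0 : ℝ) 1) (x y : ℝ) :
    F t x + G t y ≤ K t (x + y) := by
  by_contra! hneg
  obtain ⟨θ, hθ, hθneg⟩ : ∃ θ > 0, K t (x + y) - F t x - G t y + θ * t < 0 := by
    refine ⟨(F t x + G t y - K t (x + y)) / 2, by linarith, ?_⟩
    nlinarith [ht.1, ht.2]
  let M : ℝ × ℝ × ℝ → ℝ := fun q =>
    K q.1 (q.2.1 + q.2.2) - F q.1 q.2.1 - G q.1 q.2.2 + θ * q.1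
  have hMc : ContinuousOn M (Set.Icc 0 1 ×ˢ Set.univ) := by
    have e1 : ContinuousOn (fun q : ℝ × ℝ × ℝ => Function.uncurry K (q.1, q.2.1 + q.2.2))
        (Set.Icc 0 1 ×ˢ Set.univ) :=
      hK.continuousOn.comp (by fun_prop) fun q hq => ⟨hq.1, trivial⟩
    have e2 : ContinuousOn (fun q : ℝ × ℝ × ℝ => Function.uncurry F (q.1, q.2.1))
        (Set.Icc 0 1 ×ˢ Set.univ) :=
      hF.continuousOn.comp (by fun_prop) fun q hq => ⟨hq.1, trivial⟩
    have e3 : ContinuousOn (fun q : ℝ × ℝ × ℝ => Function.uncurry G (q.1, q.2.2))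
        (Set.Icc 0 1 ×ˢ Set.univ) :=
      hG.continuousOn.comp (by fun_prop) fun q hq => ⟨hq.1, trivial⟩
    exact ((e1.sub e2).sub e3).add (by fun_prop)
  have hcpt : IsCompact (Set.Icc (0 : ℝ) 1 ×ˢ (Set.Icc (0 : ℝ) T ×ˢ Set.Icc (0 : ℝ) T)) :=
    isCompact_Icc.prod (isCompact_Icc.prod isCompact_Icc)
  obtain ⟨⟨t₀, x₀, y₀⟩, hq₀, hmin₀⟩ := hcpt.exists_isMinOn
    ⟨(0, 0, 0), by simp [hT.le]⟩
    (hMc.mono (Set.prod_mono le_rfl (Set.subset_univ _)))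
  have hmin : ∀ s ∈ Set.Icc (0 : ℝ) 1, ∀ a b, M (t₀, x₀, y₀) ≤ M (s, a, b) := by
    intro s hs a b
    have p1 : Function.Periodic (fun a => M (s, a, b)) T := fun a => by
      simp only [M]
      rw [hF.periodic s, show a + T + b = a + b + T by ring, hK.periodic s]
    obtain ⟨a', ha', hae⟩ := p1.exists_mem_Ico₀ hT a
    have p2 : Function.Periodic (fun b => M (s, a', b)) T := fun b => by
      simp only [M]
      rw [hG.periodic s, show a' + (b + T) = a' + b + T by ring, hK.periodic s]
    obtain ⟨b', hb', hbe⟩ := p2.exists_mem_Ico₀ hT b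
    rw [hae, hbe]
    exact hmin₀ ⟨hs, ⟨ha'.1, ha'.2.le⟩, ⟨hb'.1, hb'.2.le⟩⟩
  have hM0 : M (t₀, x₀, y₀) < 0 := (hmin t ht x y).trans_lt hθneg
  have ht₀ : 0 < t₀ := by
    refine hq₀.1.1.lt_of_ne' fun h => ?_
    obtain rfl : t₀ = 0 := h
    simp only [M] at hM0
    linarith [h0 x₀ y₀]
  have htI : t₀ ∈ Set.Icc (0 : ℝ) 1 := hq₀.1
  have dF := hF.hasDerivAt t₀ ht₀
  have dG := hG.hasDerivAt t₀ ht₀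
  have dK := hK.hasDerivAt t₀ ht₀
  have ddF := hF.hasDerivAt_deriv t₀ ht₀
  have ddG := hG.hasDerivAt_deriv t₀ ht₀
  have ddK := hK.hasDerivAt_deriv t₀ ht₀
  have hline : ∀ a b s : ℝ, HasDerivAt (fun s => M (t₀, x₀ + a * s, y₀ + b * s))
      ((a + b) * K₁ t₀ (x₀ + y₀ + (a + b) * s) - a * F₁ t₀ (x₀ + a * s)
        - b * G₁ t₀ (y₀ + b * s)) s := fun a b s => by
    have e : ∀ c z : ℝ, HasDerivAt (fun s => z + c * s) c s := fun c z => by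
      simpa using ((hasDerivAt_id s).const_mul c).const_add z
    have k := ((((dK _).comp s (e (a + b) (x₀ + y₀))).sub ((dF _).comp s (e a x₀))).sub
      ((dG _).comp s (e b y₀))).add_const (θ * t₀)
    refine (k.congr_deriv (by ring)).congr_of_eventuallyEq (Eventually.of_forall fun s => ?_)
    simp only [M, Function.comp, Pi.sub_apply]
    ring_nf
  have hline₂ : ∀ a b : ℝ, HasDerivAt (fun s => (a + b) * K₁ t₀ (x₀ + y₀ + (a + b) * s)
        - a * F₁ t₀ (x₀ + a * s) - b * G₁ t₀ (y₀ + b * s))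
      ((a + b) ^ 2 * K₂ t₀ (x₀ + y₀) - a ^ 2 * F₂ t₀ x₀ - b ^ 2 * G₂ t₀ y₀) 0 := fun a b => by
    have e : ∀ c z : ℝ, HasDerivAt (fun s => z + c * s) c 0 := fun c z => by
      simpa using ((hasDerivAt_id (0 : ℝ)).const_mul c).const_add z
    have k := ((((ddK _).comp 0 (e (a + b) (x₀ + y₀))).const_mul (a + b)).sub
      (((ddF _).comp 0 (e a x₀)).const_mul a)).sub (((ddG _).comp 0 (e b y₀)).const_mul b)
    refine k.congr_deriv ?_
    simp only [mul_zero, add_zero]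
    ring
  have hmin' : ∀ a b s : ℝ, M (t₀, x₀ + a * 0, y₀ + b * 0) ≤ M (t₀, x₀ + a * s, y₀ + b * s) :=
    fun a b s => by simpa using hmin t₀ htI (x₀ + a * s) (y₀ + b * s)
  have first : ∀ a b : ℝ, (a + b) * K₁ t₀ (x₀ + y₀) - a * F₁ t₀ x₀ - b * G₁ t₀ y₀ = 0 :=
    fun a b => by
      have hl : IsLocalMin (fun s => M (t₀, x₀ + a * s, y₀ + b * s)) 0 :=
        Eventually.of_forall (hmin' a b)
      simpa using hl.hasDerivAt_eq_zero (hline a b 0)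
  have second : ∀ a b : ℝ,
      0 ≤ (a + b) ^ 2 * K₂ t₀ (x₀ + y₀) - a ^ 2 * F₂ t₀ x₀ - b ^ 2 * G₂ t₀ y₀ :=
    fun a b => second_deriv_nonneg_of_forall_le (hline a b) (hline₂ a b) (hmin' a b)
  have htime : HasDerivAt (fun s => M (s, x₀, y₀))
      ((v / 2 * K₂ t₀ (x₀ + y₀) - K t₀ (x₀ + y₀) * K₁ t₀ (x₀ + y₀) ^ 2 / 2)
        - (v / 2 * F₂ t₀ x₀ - F t₀ x₀ * F₁ t₀ x₀ ^ 2 / 2)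
        - (v / 2 * G₂ t₀ y₀ - G t₀ y₀ * G₁ t₀ y₀ ^ 2 / 2) + θ) t₀ := by
    have e : HasDerivAt (fun s : ℝ => θ * s) θ t₀ := by
      simpa using (hasDerivAt_id t₀).const_mul θ
    exact (((hK.hasDerivAt_time t₀ ht₀ (x₀ + y₀)).sub (hF.hasDerivAt_time t₀ ht₀ x₀)).sub
      (hG.hasDerivAt_time t₀ ht₀ y₀)).add e
  have htle : (v / 2 * K₂ t₀ (x₀ + y₀) - K t₀ (x₀ + y₀) * K₁ t₀ (x₀ + y₀) ^ 2 / 2)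
        - (v / 2 * F₂ t₀ x₀ - F t₀ x₀ * F₁ t₀ x₀ ^ 2 / 2)
        - (v / 2 * G₂ t₀ y₀ - G t₀ y₀ * G₁ t₀ y₀ ^ 2 / 2) + θ ≤ 0 := by
    refine le_of_tendsto (htime.tendsto_slope.mono_left (nhdsLT_le_nhdsNE t₀)) ?_
    filter_upwards [Ioo_mem_nhdsLT ht₀] with s hs
    rw [slope_def_field]
    refine div_nonpos_of_nonneg_of_nonpos ?_ (by linarith [hs.2])
    linarith [hmin s ⟨hs.1.le, hs.2.le.trans htI.2⟩ x₀ y₀]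
  have f1 := first 1 0
  have f2 := first 0 1
  have hFK : F₁ t₀ x₀ = K₁ t₀ (x₀ + y₀) := by linarith
  have hGK : G₁ t₀ y₀ = K₁ t₀ (x₀ + y₀) := by linarith
  rw [hFK, hGK] at htle
  have s1 := second 1 0
  have s2 := second 0 1
  have s3 := second 1 (-1)
  have hE : 0 ≤ K₂ t₀ (x₀ + y₀) - F₂ t₀ x₀ - G₂ t₀ y₀ := by nlinarith
  have hC : K t₀ (x₀ + y₀) - F t₀ x₀ - G t₀ y₀ ≤ 0 := by
    simp only [M] at hM0
    nlinarith
  nlinarith [mul_nonneg hv.le hE, mul_nonneg (sq_nonneg (K₁ t₀ (x₀ + y₀))) (sub_nonneg.2 hC)]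

open ProbabilityTheory in
/-- A bounded `T`-periodic solution of the heat equation `∂ₜ u = (v / 2) ∂ₓₓ u`, with its Gaussian
representation. -/
structure IsHeatFlow (v : ℝ≥0) (T : ℝ) (u u₁ u₂ : ℝ → ℝ → ℝ) : Prop where
  continuous : Continuous (Function.uncurry u)
  periodic : ∀ t, Function.Periodic (u t) T
  hasDerivAt : ∀ t x, HasDerivAt (u t) (u₁ t x) x
  hasDerivAt_deriv : ∀ t x, HasDerivAt (u₁ t) (u₂ t x) x
  hasDerivAt_time : ∀ t x, HasDerivAt (fun s => u s x) (v / 2 * u₂ t x) t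
  bounded : ∃ M, ∀ x, |u 0 x| ≤ M
  eq_integral : ∀ (t : ℝ≥0) (x : ℝ), u t x = ∫ w, u 0 (x + w) ∂gaussianReal 0 (t * v)

namespace IsHeatFlow

open ProbabilityTheory

variable {v : ℝ≥0} {T : ℝ} {u u₁ u₂ w w₁ w₂ : ℝ → ℝ → ℝ}

theorem integrable (h : IsHeatFlow v T u u₁ u₂) (t : ℝ≥0) (x : ℝ) :
    Integrable (fun w => u 0 (x + w)) (gaussianReal 0 (t * v)) := by
  obtain ⟨M, hM⟩ := h.bounded
  have hc : Continuous (u 0) := continuous_iff_continuousAt.2 fun x =>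
    (h.hasDerivAt 0 x).continuousAt
  exact Integrable.of_bound (by fun_prop : Continuous fun w => u 0 (x + w)).aestronglyMeasurable M
    (ae_of_all _ fun w => hM _)

theorem zero : IsHeatFlow v T 0 0 0 where
  continuous := continuous_const
  periodic t x := rfl
  hasDerivAt t x := hasDerivAt_const _ _
  hasDerivAt_deriv t x := hasDerivAt_const _ _
  hasDerivAt_time t x := by simpa using hasDerivAt_const t (0 : ℝ)
  bounded := ⟨0, by simp⟩
  eq_integral t x := by simp

theorem add (h : IsHeatFlow v T u u₁ u₂) (h' : IsHeatFlow v T w w₁ w₂) :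
    IsHeatFlow v T (u + w) (u₁ + w₁) (u₂ + w₂) where
  continuous := h.continuous.add h'.continuous
  periodic t := (h.periodic t).add (h'.periodic t)
  hasDerivAt t x := (h.hasDerivAt t x).add (h'.hasDerivAt t x)
  hasDerivAt_deriv t x := (h.hasDerivAt_deriv t x).add (h'.hasDerivAt_deriv t x)
  hasDerivAt_time t x :=
    ((h.hasDerivAt_time t x).add (h'.hasDerivAt_time t x)).congr_deriv (by simp [mul_add])
  bounded := by
    obtain ⟨M, hM⟩ := h.bounded
    obtain ⟨N, hN⟩ := h'.bounded
    exact ⟨M + N, fun x => (abs_add_le _ _).trans (add_le_add (hM x) (hN x))⟩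
  eq_integral t x := by
    simp only [Pi.add_apply]
    rw [integral_add (h.integrable t x) (h'.integrable t x), ← h.eq_integral, ← h'.eq_integral]

/-- The heat flow started from a real trigonometric monomial. -/
theorem exp (v : ℝ≥0) (a : ℂ) (ω : ℝ) (hω : Complex.exp (ω * T * Complex.I) = 1) :
    IsHeatFlow v T
      (fun t x => (a * Complex.exp (-(v / 2) * ω ^ 2 * t + ω * x * Complex.I)).re)
      (fun t x => (ω * Complex.I * a
        * Complex.exp (-(v / 2) * ω ^ 2 * t + ω * x * Complex.I)).re)
      (fun t x => ((ω * Complex.I) ^ 2 * a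
        * Complex.exp (-(v / 2) * ω ^ 2 * t + ω * x * Complex.I)).re) where
  continuous := by
    simp only [Function.uncurry_def]
    fun_prop
  periodic t x := by
    have : (-(v / 2) * ω ^ 2 * t + ω * (x + T : ℝ) * Complex.I : ℂ)
        = (-(v / 2) * ω ^ 2 * t + ω * x * Complex.I) + ω * T * Complex.I := by push_cast; ring
    simp only [this]
    rw [Complex.exp_add _ (ω * T * Complex.I), hω, mul_one]
  hasDerivAt t x := by
    have k : HasDerivAt (fun z : ℂ => -(v / 2) * ω ^ 2 * t + ω * z * Complex.I)
        (ω * Complex.I) (x : ℂ) := by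
      simpa using (((hasDerivAt_id (x : ℂ)).const_mul (ω : ℂ)).mul_const Complex.I).const_add
        (-(v / 2) * ω ^ 2 * t : ℂ)
    exact ((k.cexp.const_mul a).congr_deriv (by ring)).real_of_complex
  hasDerivAt_deriv t x := by
    have k : HasDerivAt (fun z : ℂ => -(v / 2) * ω ^ 2 * t + ω * z * Complex.I)
        (ω * Complex.I) (x : ℂ) := by
      simpa using (((hasDerivAt_id (x : ℂ)).const_mul (ω : ℂ)).mul_const Complex.I).const_add
        (-(v / 2) * ω ^ 2 * t : ℂ)
    exact ((k.cexp.const_mul (ω * Complex.I * a)).congr_deriv (by ring)).real_of_complex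
  hasDerivAt_time t x := by
    have k : HasDerivAt (fun z : ℂ => -(v / 2) * ω ^ 2 * z + ω * x * Complex.I)
        (-(v / 2) * ω ^ 2 : ℂ) (t : ℂ) := by
      simpa only [mul_one, id] using ((hasDerivAt_id (t : ℂ)).const_mul
        (-(v / 2) * ω ^ 2 : ℂ)).add_const (ω * x * Complex.I : ℂ)
    refine (k.cexp.const_mul a).real_of_complex.congr_deriv ?_
    rw [← Complex.re_ofReal_mul]
    congr 1
    push_cast
    rw [mul_pow, Complex.I_sq]
    ring
  bounded := by
    refine ⟨‖a‖, fun x => (Complex.abs_re_le_norm _).trans ?_⟩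
    simp [Complex.norm_exp]
  eq_integral t x := by
    have hi : Integrable (fun w : ℝ => Complex.exp (ω * w * Complex.I)) (gaussianReal 0 (t * v)) :=
      Integrable.of_bound (by fun_prop : Continuous fun w : ℝ => Complex.exp (ω * w * Complex.I)
        ).aestronglyMeasurable 1 (ae_of_all _ fun w => by simp [Complex.norm_exp])
    have e : ∀ w : ℝ,
        (a * Complex.exp (-(v / 2) * ω ^ 2 * (0 : ℝ) + ω * (x + w : ℝ) * Complex.I)).re
        = RCLike.re (a * Complex.exp (ω * x * Complex.I) * Complex.exp (ω * w * Complex.I)) :=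
      fun w => by
        rw [mul_assoc a, ← Complex.exp_add]
        simp only [RCLike.re_eq_complex_re]
        congr 3
        push_cast
        ring
    simp only [e]
    rw [integral_re (hi.const_mul _), integral_const_mul, ← charFun_apply_real,
      charFun_gaussianReal, RCLike.re_eq_complex_re, mul_assoc a, ← Complex.exp_add]
    congr 3
    push_cast
    ring

end IsHeatFlow

/-- Continuous periodic functions are uniform limits of initial data of heat flows. -/
theorem exists_isHeatFlow_near (v : ℝ≥0) {T : ℝ} [hT : Fact (0 < T)] (f : C(AddCircle T, ℝ)) {ε : ℝ}
    (hε : 0 < ε) :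
    ∃ u u₁ u₂, IsHeatFlow v T u u₁ u₂ ∧ ∀ x : ℝ, |u 0 x - f x| < ε := by
  let g : C(AddCircle T, ℂ) := ⟨fun x => (f x : ℂ), by fun_prop⟩
  have hg : g ∈ (Submodule.span ℂ (Set.range (@fourier T))).topologicalClosure := by
    rw [span_fourier_closure_eq_top]; trivial
  obtain ⟨q, hq, hqg⟩ := Metric.mem_closure_iff.1 hg ε hε
  have key : ∃ u u₁ u₂, IsHeatFlow v T u u₁ u₂ ∧ ∀ x : ℝ, u 0 x = (q x).re := by
    obtain ⟨c, rfl⟩ := Finsupp.mem_span_range_iff_exists_finsupp.1 hq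
    rw [Finsupp.sum]
    clear hq hqg
    induction c.support using Finset.induction_on with
    | empty => exact ⟨0, 0, 0, IsHeatFlow.zero, by simp⟩
    | insert k s hk ih =>
      obtain ⟨u, u₁, u₂, hu, hux⟩ := ih
      have hT0 : (T : ℂ) ≠ 0 := by exact_mod_cast hT.out.ne'
      have hω : Complex.exp ((2 * π * k / T : ℝ) * T * Complex.I) = 1 := by
        rw [Complex.exp_eq_one_iff]
        refine ⟨k, ?_⟩
        push_cast
        field_simp
      refine ⟨_, _, _, (IsHeatFlow.exp v (c k) _ hω).add hu, fun x => ?_⟩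
      rw [Finset.sum_insert hk]
      simp only [Pi.add_apply, hux, ContinuousMap.add_apply, Complex.add_re]
      congr 2
      simp only [ContinuousMap.smul_apply, fourier_coe_apply, smul_eq_mul]
      congr 2
      push_cast
      field_simp
      ring
  obtain ⟨u, u₁, u₂, hu, hux⟩ := key
  refine ⟨u, u₁, u₂, hu, fun x => ?_⟩
  have h1 : dist (g x) (q x) < ε := (ContinuousMap.dist_apply_le_dist _).trans_lt hqg
  rw [dist_comm, dist_eq_norm] at h1
  refine lt_of_le_of_lt ?_ h1
  rw [hux]
  simpa [g] using Complex.abs_re_le_norm (q x - g x)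

open ProbabilityTheory

theorem integral_mem_Ioo_zero_one {α : Type*} [MeasurableSpace α] {ν : Measure α}
    [IsProbabilityMeasure ν] {f : α → ℝ} (hf : AEStronglyMeasurable f ν)
    (h01 : ∀ x, f x ∈ Set.Ioo (0 : ℝ) 1) :
    ∫ x, f x ∂ν ∈ Set.Ioo (0 : ℝ) 1 := by
  have key : ∀ g : α → ℝ, Integrable g ν → (∀ x, 0 < g x) → 0 < ∫ x, g x ∂ν := fun g hg hpos => by
    rw [integral_pos_iff_support_of_nonneg (fun x => (hpos x).le) hg,
      show Function.support g = Set.univ from Set.eq_univ_of_forall fun x => (hpos x).ne']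
    simp
  have hi : Integrable f ν := Integrable.of_bound hf 1 (ae_of_all _ fun x => by
    rw [Real.norm_eq_abs, abs_of_pos (h01 x).1]; exact (h01 x).2.le)
  refine ⟨key f hi fun x => (h01 x).1, ?_⟩
  have := key (fun x => 1 - f x) ((integrable_const 1).sub hi) fun x => sub_pos.2 (h01 x).2
  rw [integral_sub (integrable_const 1) hi] at this
  simpa using this

namespace IsHeatFlow

variable {v : ℝ≥0} {T : ℝ} {u u₁ u₂ : ℝ → ℝ → ℝ}

theorem neg (h : IsHeatFlow v T u u₁ u₂) : IsHeatFlow v T (-u) (-u₁) (-u₂) where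
  continuous := h.continuous.neg
  periodic t := fun x => congrArg Neg.neg (h.periodic t x)
  hasDerivAt t x := (h.hasDerivAt t x).neg
  hasDerivAt_deriv t x := (h.hasDerivAt_deriv t x).neg
  hasDerivAt_time t x := (h.hasDerivAt_time t x).neg.congr_deriv (by simp)
  bounded := by
    obtain ⟨M, hM⟩ := h.bounded
    exact ⟨M, fun x => by simpa using hM x⟩
  eq_integral t x := by
    simp only [Pi.neg_apply]
    rw [integral_neg, ← h.eq_integral]

theorem mem_Ioo (h : IsHeatFlow v T u u₁ u₂) (h01 : ∀ x, u 0 x ∈ Set.Ioo (0 : ℝ) 1) {t : ℝ}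
    (ht : 0 ≤ t) (x : ℝ) : u t x ∈ Set.Ioo (0 : ℝ) 1 := by
  lift t to ℝ≥0 using ht
  rw [h.eq_integral]
  exact integral_mem_Ioo_zero_one (h.integrable _ x).aestronglyMeasurable fun w => h01 _

/-- The Gaussian quantile of a heat flow is a quantile flow. -/
theorem isQuantileFlow {p Φ Ψ : ℝ → ℝ} (h : IsHeatFlow v T u u₁ u₂) (hv : v ≠ 0)
    (hq : IsQuantilePair p Φ Ψ) (hp : ∀ s, HasDerivAt p (-(s / v) * p s) s)
    (h01 : ∀ x, u 0 x ∈ Set.Ioo (0 : ℝ) 1) :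
    IsQuantileFlow v T (fun t x => Ψ (u t x)) (fun t x => u₁ t x * (p (Ψ (u t x)))⁻¹)
      (fun t x => u₂ t x * (p (Ψ (u t x)))⁻¹
        + Ψ (u t x) * (u₁ t x * (p (Ψ (u t x)))⁻¹) ^ 2 / v) := by
  have hv' : (v : ℝ) ≠ 0 := by exact_mod_cast hv
  have dx : ∀ t, 0 < t → ∀ x,
      HasDerivAt (fun x => Ψ (u t x)) (u₁ t x * (p (Ψ (u t x)))⁻¹) x := fun t ht x =>
    ((hq.hasDerivAt_quantile (h.mem_Ioo h01 ht.le x)).comp x (h.hasDerivAt t x)).congr_deriv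
      (mul_comm _ _)
  refine ⟨fun q hq' => ?_, fun t x => congrArg Ψ (h.periodic t x), dx, fun t ht x => ?_,
    fun t ht x => ?_⟩
  · exact (ContinuousAt.comp (f := Function.uncurry u)
      (hq.continuousAt_quantile (h.mem_Ioo h01 hq'.1.1 q.2))
      h.continuous.continuousAt).continuousWithinAt
  · have hpos := (hq.pos (Ψ (u t x))).ne'
    refine ((h.hasDerivAt_deriv t x).mul (((hp _).comp x (dx t ht x)).inv hpos)).congr_deriv ?_
    simp only [Function.comp, Pi.inv_apply]
    field_simp
  · have hpos := (hq.pos (Ψ (u t x))).ne'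
    refine ((hq.hasDerivAt_quantile (h.mem_Ioo h01 ht.le x)).comp t
      (h.hasDerivAt_time t x)).congr_deriv ?_
    field_simp
    ring

end IsHeatFlow

/-- A bounded upper semicontinuous function is approximated from above by continuous functions. -/
theorem UpperSemicontinuous.exists_seq_continuous_ge {X : Type*} [PseudoMetricSpace X] {f : X → ℝ}
    (hf : UpperSemicontinuous f) {M : ℝ} (hM : ∀ x, |f x| ≤ M) :
    ∃ φ : ℕ → C(X, ℝ), (∀ n x, f x ≤ φ n x) ∧
      ∀ x, ∀ κ > 0, ∀ᶠ q in atTop ×ˢ 𝓝 x, φ q.1 q.2 < f x + κ := by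
  have hbdd : ∀ (n : ℕ) x, BddAbove (Set.range fun w => f w - n * dist x w) := fun n x => by
    refine ⟨M, ?_⟩
    rintro _ ⟨w, rfl⟩
    have := (abs_le.1 (hM w)).2
    have : 0 ≤ n * dist x w := by positivity
    simp only
    linarith
  have hlip : ∀ n : ℕ, LipschitzWith n fun x => ⨆ w, f w - n * dist x w := fun n =>
    LipschitzWith.of_le_add_mul _ fun x y => by
      have : Nonempty X := ⟨x⟩
      refine ciSup_le fun w => ?_
      have h1 := le_ciSup (hbdd n y) w
      have h2 := mul_le_mul_of_nonneg_left (dist_triangle y x w) (Nat.cast_nonneg n : (0 : ℝ) ≤ n)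
      rw [dist_comm y x] at h2
      simp only [NNReal.coe_natCast] at h1 ⊢
      linarith
  refine ⟨fun n => ⟨_, (hlip n).continuous⟩, fun n x => ?_, fun x κ hκ => ?_⟩
  · simpa using le_ciSup (hbdd n x) x
  · obtain ⟨r, hr, hball⟩ := Metric.eventually_nhds_iff_ball.1 (hf x (f x + κ / 2) (by linarith))
    obtain ⟨N, hN⟩ := exists_nat_gt (2 * (2 * M) / r)
    have h1 : ∀ᶠ n : ℕ in atTop, N ≤ n := eventually_ge_atTop N
    filter_upwards [h1.prod_mk (Metric.ball_mem_nhds x (half_pos hr))] with q hq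
    obtain ⟨n, y⟩ := q
    obtain ⟨hn, hy⟩ := hq
    simp only [ContinuousMap.coe_mk] at hn hy ⊢
    have : Nonempty X := ⟨x⟩
    refine lt_of_le_of_lt (ciSup_le fun w => ?_) (by linarith : f x + κ / 2 < f x + κ)
    have h0 : 0 ≤ n * dist y w := by positivity
    by_cases hw : w ∈ Metric.ball x r
    · have := hball w hw
      linarith
    · have hd : r / 2 ≤ dist y w := by
        have := dist_triangle w y x
        rw [Metric.mem_ball, not_lt] at hw
        rw [dist_comm w y] at this
        linarith
      have hn' : (N : ℝ) ≤ n := by exact_mod_cast hn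
      rw [div_lt_iff₀ hr] at hN
      have h3 : (N : ℝ) * (r / 2) ≤ n * dist y w := by gcongr
      have := (abs_le.1 (hM w)).2
      have := (abs_le.1 (hM x)).1
      linarith

theorem UpperSemicontinuous.exists_seq_isHeatFlow_gt (v : ℝ≥0) {T : ℝ} [Fact (0 < T)]
    {f : AddCircle T → ℝ} (hf : UpperSemicontinuous f) {M : ℝ} (hM : ∀ x, |f x| ≤ M) :
    ∃ u u₁ u₂ : ℕ → ℝ → ℝ → ℝ, (∀ n, IsHeatFlow v T (u n) (u₁ n) (u₂ n)) ∧
      (∀ n (x : ℝ), f x < u n 0 x) ∧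
      ∀ α, ∀ κ > 0, ∀ᶠ q in atTop ×ˢ 𝓝 α, ∀ x : ℝ, (x : AddCircle T) = q.2 →
        u q.1 0 x < f α + κ := by
  obtain ⟨φ, hφ, hφlim⟩ := hf.exists_seq_continuous_ge hM
  have hε : ∀ n : ℕ, (0 : ℝ) < 1 / (n + 1) := fun n => by positivity
  choose u u₁ u₂ hu hclose using fun n =>
    exists_isHeatFlow_near v (φ n + ContinuousMap.const _ (1 / ((n : ℝ) + 1))) (hε n)
  refine ⟨u, u₁, u₂, hu, fun n x => ?_, fun α κ hκ => ?_⟩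
  · have h1 := (abs_lt.1 (hclose n x)).1
    have h2 := hφ n x
    simp only [ContinuousMap.add_apply, ContinuousMap.const_apply] at h1
    linarith
  · have h1 : ∀ᶠ n : ℕ in atTop, 1 / ((n : ℝ) + 1) < κ / 4 :=
      tendsto_one_div_add_atTop_nhds_zero_nat.eventually_lt_const (by linarith)
    filter_upwards [hφlim α (κ / 2) (by linarith), h1.prod_inl _] with q hq hq1 x hx
    have h2 := (abs_lt.1 (hclose q.1 x)).2
    simp only [ContinuousMap.add_apply, ContinuousMap.const_apply, hx] at h2
    linarith


/-- The functional Ehrhard inequality for semicontinuous functions on a circle. -/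
theorem ehrhard_addCircle {v : ℝ≥0} (hv : v ≠ 0) {p Φ Ψ : ℝ → ℝ} (hq : IsQuantilePair p Φ Ψ)
    (hp : ∀ s, HasDerivAt p (-(s / v) * p s) s) {T : ℝ} [hT : Fact (0 < T)]
    {f g h : AddCircle T → ℝ} (hf : UpperSemicontinuous f) (hg : UpperSemicontinuous g)
    (hh : LowerSemicontinuous h) (hf01 : ∀ α, f α ∈ Set.Ioo (0 : ℝ) 1)
    (hg01 : ∀ α, g α ∈ Set.Ioo (0 : ℝ) 1) (hh01 : ∀ α, h α ∈ Set.Icc (0 : ℝ) 1)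
    (hfgh : ∀ α β, Φ (Ψ (f α) + Ψ (g β)) < h (α + β)) :
    Φ (Ψ (∫ x : ℝ, f x ∂gaussianReal 0 v)
        + Ψ (∫ x : ℝ, g x ∂gaussianReal 0 v))
      ≤ ∫ x : ℝ, h x ∂gaussianReal 0 v := by
  obtain ⟨u, u₁, u₂, hu, hfu, hulim⟩ := hf.exists_seq_isHeatFlow_gt v (M := 1)
    fun α => abs_le.2 ⟨by linarith [(hf01 α).1], (hf01 α).2.le⟩
  obtain ⟨w, w₁, w₂, hw, hgw, hwlim⟩ := hg.exists_seq_isHeatFlow_gt v (M := 1)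
    fun α => abs_le.2 ⟨by linarith [(hg01 α).1], (hg01 α).2.le⟩
  obtain ⟨k, k₁, k₂, hk, hhk, hklim⟩ := hh.neg.exists_seq_isHeatFlow_gt v (M := 1)
    fun α => by
      rw [Pi.neg_apply, abs_neg]
      exact abs_le.2 ⟨by linarith [(hh01 α).1], (hh01 α).2⟩
  simp only [Pi.neg_apply] at hhk hklim
  have hloc : ∀ q ∈ (Set.univ : Set (AddCircle T × AddCircle T)),
      {z : ℕ × AddCircle T × AddCircle T | ∀ x y : ℝ, (x : AddCircle T) = z.2.1 →
        (y : AddCircle T) = z.2.2 → u z.1 0 x < 1 ∧ w z.1 0 y < 1 ∧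
          Φ (Ψ (u z.1 0 x) + Ψ (w z.1 0 y)) < -k z.1 0 (x + y)} ∈ atTop ×ˢ 𝓝 q := by
    rintro ⟨α, β⟩ -
    have c1 : ContinuousAt (fun κ => Ψ (f α + κ)) 0 :=
      ContinuousAt.comp (by simpa using hq.continuousAt_quantile (hf01 α)) (by fun_prop)
    have c2 : ContinuousAt (fun κ => Ψ (g β + κ)) 0 :=
      ContinuousAt.comp (by simpa using hq.continuousAt_quantile (hg01 β)) (by fun_prop)
    have c3 : ContinuousAt (fun κ => Φ (Ψ (f α + κ) + Ψ (g β + κ)) + κ) 0 :=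
      (hq.continuous.continuousAt.comp (c1.add c2)).add continuousAt_id
    have e1 : ∀ᶠ κ in 𝓝 (0 : ℝ), Φ (Ψ (f α + κ) + Ψ (g β + κ)) + κ < h (α + β) :=
      c3.eventually_lt_const (by simpa using hfgh α β)
    have e2 : ∀ᶠ κ in 𝓝 (0 : ℝ), f α + κ < 1 :=
      (by fun_prop : ContinuousAt (fun κ => f α + κ) 0).eventually_lt_const
        (by simpa using (hf01 α).2)
    have e3 : ∀ᶠ κ in 𝓝 (0 : ℝ), g β + κ < 1 :=
      (by fun_prop : ContinuousAt (fun κ => g β + κ) 0).eventually_lt_const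
        (by simpa using (hg01 β).2)
    obtain ⟨κ, ⟨⟨hκ1, hκ2⟩, hκ3⟩, hκ⟩ := (((e1.and e2).and e3).filter_mono
      (nhdsWithin_le_nhds (s := Set.Ioi 0)) |>.and self_mem_nhdsWithin).exists
    have t1 : Tendsto (fun z : ℕ × AddCircle T × AddCircle T => (z.1, z.2.1))
        (atTop ×ˢ 𝓝 (α, β)) (atTop ×ˢ 𝓝 α) :=
      tendsto_fst.prodMk ((continuous_fst.tendsto _).comp tendsto_snd)
    have t2 : Tendsto (fun z : ℕ × AddCircle T × AddCircle T => (z.1, z.2.2))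
        (atTop ×ˢ 𝓝 (α, β)) (atTop ×ˢ 𝓝 β) :=
      tendsto_fst.prodMk ((continuous_snd.tendsto _).comp tendsto_snd)
    have t3 : Tendsto (fun z : ℕ × AddCircle T × AddCircle T => (z.1, z.2.1 + z.2.2))
        (atTop ×ˢ 𝓝 (α, β)) (atTop ×ˢ 𝓝 (α + β)) :=
      tendsto_fst.prodMk ((continuous_add.tendsto (α, β)).comp tendsto_snd)
    filter_upwards [t1.eventually (hulim α κ hκ), t2.eventually (hwlim β κ hκ),
      t3.eventually (hklim (α + β) κ hκ)] with z z1 z2 z3 x y hx hy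
    have y1 := z1 x hx
    have y2 := z2 y hy
    have y3 := z3 (x + y) (by rw [AddCircle.coe_add, hx, hy])
    have x1 : 0 < u z.1 0 x := (hf01 _).1.trans (hfu z.1 x)
    have x2 : 0 < w z.1 0 y := (hg01 _).1.trans (hgw z.1 y)
    refine ⟨y1.trans hκ2, y2.trans hκ3, ?_⟩
    have m1 := hq.strictMonoOn_quantile ⟨x1, y1.trans hκ2⟩ ⟨x1.trans y1, hκ2⟩ y1
    have m2 := hq.strictMonoOn_quantile ⟨x2, y2.trans hκ3⟩ ⟨x2.trans y2, hκ3⟩ y2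
    have m3 := hq.strictMono (add_lt_add m1 m2)
    linarith
  have hglob := isCompact_univ.mem_prod_nhdsSet_of_forall hloc
  rw [nhdsSet_univ, mem_prod_top] at hglob
  obtain ⟨n, hn⟩ := nonempty_of_mem hglob
  have key : ∀ x y : ℝ, u n 0 x < 1 ∧ w n 0 y < 1 ∧
      Φ (Ψ (u n 0 x) + Ψ (w n 0 y)) < -k n 0 (x + y) := fun x y => hn (x, y) x y rfl rfl
  have hu01 : ∀ x, u n 0 x ∈ Set.Ioo (0 : ℝ) 1 := fun x =>
    ⟨(hf01 x).1.trans (hfu n x), (key x 0).1⟩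
  have hw01 : ∀ x, w n 0 x ∈ Set.Ioo (0 : ℝ) 1 := fun x =>
    ⟨(hg01 x).1.trans (hgw n x), (key 0 x).2.1⟩
  have hk01 : ∀ x, (-k n) 0 x ∈ Set.Ioo (0 : ℝ) 1 := fun x => by
    have h1 := (key x 0).2.2
    rw [add_zero] at h1
    have h2 := hhk n x
    exact ⟨(hq.mem _).1.trans h1, (by linarith [(hh01 x).2] : -k n 0 x < 1)⟩
  have hflow := IsQuantileFlow.add_le (NNReal.coe_pos.2 (pos_iff_ne_zero.2 hv)) hT.out
    ((hu n).isQuantileFlow hv hq hp hu01) ((hw n).isQuantileFlow hv hq hp hw01)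
    ((hk n).neg.isQuantileFlow hv hq hp hk01) (fun x y => by
      rw [← hq.quantile_apply (Ψ (u n 0 x) + Ψ (w n 0 y))]
      exact (hq.strictMonoOn_quantile (hq.mem _) (hk01 _) (key x y).2.2).le)
    (t := 1) ⟨zero_le_one, le_rfl⟩ 0 0
  have mean : ∀ {U U₁ U₂ : ℝ → ℝ → ℝ}, IsHeatFlow v T U U₁ U₂ →
      U 1 0 = ∫ x, U 0 x ∂gaussianReal 0 v := fun hU => by
    have := hU.eq_integral 1 0
    simpa using this
  have hint : ∀ {F : AddCircle T → ℝ}, Measurable F → (∀ α, F α ∈ Set.Icc (0 : ℝ) 1) →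
      Integrable (fun x : ℝ => F x) (gaussianReal 0 v) := fun hF hF01 =>
    Integrable.of_bound (hF.comp AddCircle.measurable_mk').aestronglyMeasurable 1
      (ae_of_all _ fun x => by
        rw [Real.norm_eq_abs, abs_of_nonneg (hF01 x).1]
        exact (hF01 x).2)
  have hi : ∀ {U U₁ U₂ : ℝ → ℝ → ℝ}, IsHeatFlow v T U U₁ U₂ →
      Integrable (fun x => U 0 x) (gaussianReal 0 v) := fun hU => by
    simpa using hU.integrable 1 0
  have hf' : (∫ x : ℝ, f x ∂gaussianReal 0 v) ≤ u n 1 0 := by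
    rw [mean (hu n)]
    exact integral_mono (hint hf.measurable fun α => Set.Ioo_subset_Icc_self (hf01 α)) (hi (hu n))
      fun x => (hfu n x).le
  have hg' : (∫ x : ℝ, g x ∂gaussianReal 0 v) ≤ w n 1 0 := by
    rw [mean (hw n)]
    exact integral_mono (hint hg.measurable fun α => Set.Ioo_subset_Icc_self (hg01 α)) (hi (hw n))
      fun x => (hgw n x).le
  have hh' : (-k n) 1 0 ≤ ∫ x : ℝ, h x ∂gaussianReal 0 v := by
    rw [mean (hk n).neg]
    exact integral_mono (hi (hk n).neg) (hint hh.measurable hh01) fun x => by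
      have := hhk n x
      simp only [Pi.neg_apply]
      linarith
  have hfI : (∫ x : ℝ, f x ∂gaussianReal 0 v) ∈ Set.Ioo (0 : ℝ) 1 :=
    integral_mem_Ioo_zero_one (hf.measurable.comp AddCircle.measurable_mk').aestronglyMeasurable
      fun x => hf01 x
  have hgI : (∫ x : ℝ, g x ∂gaussianReal 0 v) ∈ Set.Ioo (0 : ℝ) 1 :=
    integral_mem_Ioo_zero_one (hg.measurable.comp AddCircle.measurable_mk').aestronglyMeasurable
      fun x => hg01 x
  have m1 := hq.strictMonoOn_quantile.monotoneOn hfI ((hu n).mem_Ioo hu01 zero_le_one 0) hf'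
  have m2 := hq.strictMonoOn_quantile.monotoneOn hgI ((hw n).mem_Ioo hw01 zero_le_one 0) hg'
  rw [add_zero] at hflow
  refine (hq.strictMono.monotone ((add_le_add m1 m2).trans hflow)).trans ?_
  rwa [hq.apply_quantile _ ((hk n).neg.mem_Ioo hk01 zero_le_one 0)]

theorem AddCircle.exists_mem_Ico_coe_eq {L : ℝ} [Fact (0 < 2 * L)] (α : AddCircle (2 * L)) :
    ∃ x ∈ Set.Ico (-L) L, (x : AddCircle (2 * L)) = α := by
  have h := AddCircle.coe_image_Ico_eq (2 * L) (-L)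
  rw [show -L + 2 * L = L by ring] at h
  exact h.symm.subset (Set.mem_univ α)

/-- An upper semicontinuous function that is constant near infinity descends to a large circle. -/
theorem UpperSemicontinuous.exists_addCircle {f : ℝ → ℝ} (hf : UpperSemicontinuous f) {c R L : ℝ}
    [Fact (0 < 2 * L)] (hRL : R < L) (hfc : ∀ x, R < |x| → f x = c) :
    ∃ F : AddCircle (2 * L) → ℝ, UpperSemicontinuous F ∧ ∀ x ∈ Set.Ico (-L) L, F x = f x := by
  have hL : 0 < L := by linarith [(Fact.out : 0 < 2 * L)]
  have hIco : Set.Ico (-L) (-L + 2 * L) = Set.Ico (-L) L := by ring_nf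
  have hF : ∀ x ∈ Set.Ico (-L) L, AddCircle.liftIco (2 * L) (-L) f x = f x := fun x hx =>
    AddCircle.liftIco_coe_apply (hIco ▸ hx)
  refine ⟨AddCircle.liftIco (2 * L) (-L) f, fun α y hy => ?_, hF⟩
  obtain ⟨x, hx, rfl⟩ := AddCircle.exists_mem_Ico_coe_eq α
  rw [hF x hx] at hy
  rw [QuotientAddGroup.nhds_eq, eventually_map]
  rcases hx.1.eq_or_lt with rfl | hxL
  · rw [hfc _ (by rwa [abs_neg, abs_of_pos hL])] at hy
    obtain ⟨δ, hδ, hδL, hδR⟩ : ∃ δ > 0, δ < L ∧ R ≤ L - δ :=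
      ⟨min (L / 2) (L - R), lt_min (by linarith) (by linarith),
        by linarith [min_le_left (L / 2) (L - R)], by linarith [min_le_right (L / 2) (L - R)]⟩
    filter_upwards [Ioo_mem_nhds (by linarith : -L - δ < -L) (by linarith : -L < -L + δ)] with z hz
    obtain ⟨hz1, hz2⟩ := hz
    change AddCircle.liftIco (2 * L) (-L) f (z : AddCircle (2 * L)) < y
    rcases le_or_gt (-L) z with hzL | hzL
    · rwa [hF z ⟨hzL, by linarith⟩, hfc z (by rw [abs_of_neg (by linarith)]; linarith)]
    · rwa [← AddCircle.coe_add_period, hF _ ⟨by linarith, by linarith⟩,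
        hfc _ (by rw [abs_of_pos (by linarith)]; linarith)]
  · filter_upwards [Ioo_mem_nhds hxL hx.2, hf x y hy] with z hz hzy
    exact (hF z ⟨hz.1.le, hz.2⟩).trans_lt hzy

/-- The functional Ehrhard inequality for semicontinuous functions on the line, two of which vanish
outside a bounded set. -/
theorem ehrhard_of_bounded_support {v : ℝ≥0} (hv : v ≠ 0) {p Φ Ψ : ℝ → ℝ}
    (hq : IsQuantilePair p Φ Ψ) (hp : ∀ s, HasDerivAt p (-(s / v) * p s) s) {f g h : ℝ → ℝ}
    (hf : UpperSemicontinuous f)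
    (hg : UpperSemicontinuous g) (hh : LowerSemicontinuous h) {c R : ℝ} (hc : c ∈ Set.Ioo (0 : ℝ) 1)
    (hfc : ∀ x, f x ∈ Set.Icc 0 c) (hgc : ∀ x, g x ∈ Set.Icc 0 c)
    (hh01 : ∀ x, h x ∈ Set.Icc (0 : ℝ) 1) (hfR : ∀ x, R < |x| → f x = 0)
    (hgR : ∀ x, R < |x| → g x = 0)
    (hfgh : ∀ x y, 0 < f x → 0 < g y → Φ (Ψ (f x) + Ψ (g y)) < h (x + y))
    (hf0 : 0 < ∫ x, f x ∂gaussianReal 0 v) (hg0 : 0 < ∫ x, g x ∂gaussianReal 0 v) :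
    Φ (Ψ (∫ x, f x ∂gaussianReal 0 v) + Ψ (∫ x, g x ∂gaussianReal 0 v))
      ≤ ∫ x, h x ∂gaussianReal 0 v := by
  set μ := gaussianReal 0 v
  refine le_of_forall_pos_le_add fun η' hη' => ?_
  obtain ⟨η, hη, hη1, hηη'⟩ : ∃ η > 0, η < 1 ∧ η + η ≤ η' :=
    ⟨min (1 / 2) (η' / 2), by positivity, by linarith [min_le_left (1 / 2) (η' / 2)],
      by linarith [min_le_right (1 / 2) (η' / 2)]⟩
  obtain ⟨K, hK, hKμ⟩ := isTightMeasureSet_iff_exists_isCompact_measure_compl_le.1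
    (isTightMeasureSet_singleton (μ := μ)) (ENNReal.ofReal η) (by simpa)
  obtain ⟨r, hr⟩ := hK.isBounded.subset_closedBall 0
  obtain ⟨S, hS0, hRS, hrS⟩ : ∃ S, 0 < S ∧ R ≤ S ∧ r ≤ 2 * S :=
    ⟨max 1 (max R r), by positivity, by simp, by
      have h1 : r ≤ max 1 (max R r) := by simp
      have h2 : 1 ≤ max 1 (max R r) := by simp
      linarith⟩
  have htail : μ.real {x | 2 * S < |x|} ≤ η := by
    refine ENNReal.toReal_le_of_le_ofReal hη.le ((measure_mono ?_).trans (hKμ μ rfl))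
    intro x hx hxK
    have := hr hxK
    rw [mem_closedBall_zero_iff, Real.norm_eq_abs] at this
    exact absurd hx (not_lt.2 (this.trans hrS))
  obtain ⟨s, hs⟩ := hq.exists_apply_lt hη
  obtain ⟨ε, hε, hεη⟩ : ∃ ε ∈ Set.Ioo 0 c, Φ (Ψ ε + Ψ c) < η := by
    refine ⟨min (Φ (s - Ψ c)) (c / 2), ⟨lt_min (hq.mem _).1 (by linarith [hc.1]),
      (min_le_right _ _).trans_lt (by linarith [hc.1])⟩,
        lt_of_le_of_lt (hq.strictMono.monotone ?_) hs⟩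
    have h1 : Ψ (min (Φ (s - Ψ c)) (c / 2)) ≤ Ψ (Φ (s - Ψ c)) :=
      hq.strictMonoOn_quantile.monotoneOn ⟨lt_min (hq.mem _).1 (by linarith [hc.1]),
        (min_le_right _ _).trans_lt (by linarith [hc.1, hc.2])⟩ (hq.mem _) (min_le_left _ _)
    rw [hq.quantile_apply] at h1
    linarith
  have : Fact (0 < 2 * (2 * S + 1)) := ⟨by linarith⟩
  have hopen : IsOpen {x : ℝ | 2 * S < |x|} := isOpen_lt continuous_const continuous_abs
  obtain ⟨F, hF, hFf⟩ := (hf.sup upperSemicontinuous_const (g := fun _ => ε)).exists_addCircle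
    (c := ε) (by linarith : 2 * S < 2 * S + 1) fun x hx => by
      rw [hfR x (by linarith), max_eq_right hε.1.le]
  obtain ⟨G, hG, hGg⟩ := (hg.sup upperSemicontinuous_const (g := fun _ => ε)).exists_addCircle
    (c := ε) (by linarith : 2 * S < 2 * S + 1) fun x hx => by
      rw [hgR x (by linarith), max_eq_right hε.1.le]
  obtain ⟨K, hK, hKh⟩ := ((hh.sup (lowerSemicontinuous_const (z := η))).sup
    (hopen.lowerSemicontinuous_indicator zero_le_one)).neg.exists_addCircle
    (c := -1) (by linarith : 2 * S < 2 * S + 1) fun x hx => by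
      simp [Set.indicator_of_mem (show x ∈ {x : ℝ | 2 * S < |x|} from hx), (hh01 x).2, hη1.le]
  have hFc : ∀ α, F α ∈ Set.Icc ε c := fun α => by
    obtain ⟨x, hx, rfl⟩ := AddCircle.exists_mem_Ico_coe_eq α
    rw [hFf x hx]
    exact ⟨le_max_right _ _, max_le (hfc x).2 hε.2.le⟩
  have hGc : ∀ α, G α ∈ Set.Icc ε c := fun α => by
    obtain ⟨x, hx, rfl⟩ := AddCircle.exists_mem_Ico_coe_eq α
    rw [hGg x hx]
    exact ⟨le_max_right _ _, max_le (hgc x).2 hε.2.le⟩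
  have hsub : Set.Icc ε c ⊆ Set.Ioo 0 1 := fun x hx => ⟨hε.1.trans_le hx.1, hx.2.trans_lt hc.2⟩
  have hmono := hq.strictMonoOn_quantile.monotoneOn
  have hKη : ∀ α, (-K) α ∈ Set.Icc η 1 := fun α => by
    obtain ⟨x, hx, rfl⟩ := AddCircle.exists_mem_Ico_coe_eq α
    rw [Pi.neg_apply, hKh x hx, Pi.neg_apply, neg_neg]
    exact ⟨(le_max_right _ _).trans (le_max_left _ _), max_le (max_le (hh01 x).2 hη1.le)
      (Set.indicator_le' (fun _ _ => le_rfl) (fun _ _ => zero_le_one) x)⟩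
  have hcircle : ∀ α β, Φ (Ψ (F α) + Ψ (G β)) < (-K) (α + β) := fun α β => by
    obtain ⟨x, hx, rfl⟩ := AddCircle.exists_mem_Ico_coe_eq α
    obtain ⟨y, hy, rfl⟩ := AddCircle.exists_mem_Ico_coe_eq β
    rcases le_or_gt (f x) ε with hfx | hfx
    · refine ((hq.strictMono.monotone ?_).trans_lt hεη).trans_le (hKη _).1
      rw [hFf x hx, max_eq_right hfx]
      exact add_le_add_right (hmono (hsub (hGc _)) hc (hGc _).2) _
    rcases le_or_gt (g y) ε with hgy | hgy
    · refine ((hq.strictMono.monotone ?_).trans_lt hεη).trans_le (hKη _).1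
      rw [hGg y hy, max_eq_right hgy, add_comm]
      exact add_le_add_right (hmono (hsub (hFc _)) hc (hFc _).2) _
    have hxS : |x| ≤ S := by
      by_contra! hlt
      linarith [hfR x (hRS.trans_lt hlt), hε.1]
    have hyS : |y| ≤ S := by
      by_contra! hlt
      linarith [hgR y (hRS.trans_lt hlt), hε.1]
    rw [abs_le] at hxS hyS
    rw [hFf x hx, hGg y hy, max_eq_left hfx.le, max_eq_left hgy.le, ← AddCircle.coe_add,
      Pi.neg_apply, hKh _ ⟨by linarith, by linarith⟩, Pi.neg_apply, neg_neg]
    exact (hfgh x y (hε.1.trans hfx) (hε.1.trans hgy)).trans_le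
      ((le_max_left _ _).trans (le_max_left _ _))
  have main := ehrhard_addCircle hv hq hp hF hG hK.neg (fun α => hsub (hFc α))
    (fun α => hsub (hGc α)) (fun α => ⟨hη.le.trans (hKη α).1, (hKη α).2⟩) hcircle
  have hlower : ∀ {φ : ℝ → ℝ} {Θ : AddCircle (2 * (2 * S + 1)) → ℝ}, UpperSemicontinuous φ →
      (∀ x, φ x ∈ Set.Icc 0 c) → (∀ x, R < |x| → φ x = 0) → UpperSemicontinuous Θ →
      (∀ α, Θ α ∈ Set.Icc ε c) → (∀ x ∈ Set.Ico (-(2 * S + 1)) (2 * S + 1), Θ x = max (φ x) ε) →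
      0 < ∫ x, φ x ∂μ → Ψ (∫ x, φ x ∂μ) ≤ Ψ (∫ x : ℝ, Θ x ∂μ) := by
    intro φ Θ hφ hφc hφR hΘ hΘc hΘφ hpos
    have hmeas := (hΘ.measurable.comp AddCircle.measurable_mk').aestronglyMeasurable (μ := μ)
    have hle : ∫ x, φ x ∂μ ≤ ∫ x : ℝ, Θ x ∂μ := by
      refine integral_mono (Integrable.of_mem_Icc 0 c hφ.measurable.aemeasurable (ae_of_all _ hφc))
        (Integrable.of_mem_Icc ε c hmeas.aemeasurable (ae_of_all _ fun x => hΘc x)) fun x => ?_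
      by_cases hx : R < |x|
      · exact (hφR x hx).trans_le (hε.1.le.trans (hΘc x).1)
      · have := abs_le.1 (not_lt.1 hx)
        simp only [hΘφ x ⟨by linarith, by linarith⟩, le_max_left]
    have hmem := integral_mem_Ioo_zero_one hmeas fun x => hsub (hΘc x)
    exact hmono ⟨hpos, hle.trans_lt hmem.2⟩ hmem hle
  have hupper : ∫ x : ℝ, (-K) x ∂μ ≤ ∫ x, h x ∂μ + (η + η) := by
    have hhi : Integrable h μ :=
      Integrable.of_mem_Icc 0 1 hh.measurable.aemeasurable (ae_of_all _ hh01)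
    have hind : Integrable (Set.indicator {x : ℝ | 2 * S < |x|} fun _ => (1 : ℝ)) μ :=
      (integrable_const 1).indicator hopen.measurableSet
    calc ∫ x : ℝ, (-K) x ∂μ
        ≤ ∫ x, (h x + (η + Set.indicator {x : ℝ | 2 * S < |x|} (fun _ => (1 : ℝ)) x)) ∂μ := by
          refine integral_mono (Integrable.of_mem_Icc η 1
            (hK.neg.measurable.comp AddCircle.measurable_mk').aemeasurable
            (ae_of_all _ fun x => hKη x)) (hhi.add ((integrable_const η).add hind)) fun x => ?_
          by_cases hx : 2 * S < |x|
          · simp only [Set.indicator_of_mem (show x ∈ {x : ℝ | 2 * S < |x|} from hx)]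
            linarith [(hKη x).2, (hh01 x).1]
          · have := abs_le.1 (not_lt.1 hx)
            simp only [Pi.neg_apply, hKh x ⟨by linarith, by linarith⟩, neg_neg,
              Set.indicator_of_notMem (show x ∉ {x : ℝ | 2 * S < |x|} from hx), add_zero]
            exact max_le (max_le (by linarith) (by linarith [(hh01 x).1]))
              (by linarith [(hh01 x).1])
      _ = ∫ x, h x ∂μ + (η + μ.real {x | 2 * S < |x|}) := by
          have h2 : ∫ x, (η + Set.indicator {x : ℝ | 2 * S < |x|} (fun _ => (1 : ℝ)) x) ∂μ
              = η + μ.real {x | 2 * S < |x|} := by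
            rw [integral_add (integrable_const η) hind,
              integral_indicator_const _ hopen.measurableSet]
            simp
          rw [← h2]
          exact integral_add hhi ((integrable_const η).add hind)
      _ ≤ ∫ x, h x ∂μ + (η + η) := by gcongr
  exact ((hq.strictMono.monotone (add_le_add (hlower hf hfc hfR hF hFc hFf hf0)
    (hlower hg hgc hgR hG hGc hGg hg0))).trans main).trans (hupper.trans (by gcongr))

/-- Truncations of a function `f` into `[0, 1]` supported where `f` is positive, inside a
given set. -/
theorem exists_upperSemicontinuous_lt {μ : Measure ℝ} [IsProbabilityMeasure μ] {f : ℝ → ℝ}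
    (hf : Measurable f) (hf01 : ∀ x, f x ∈ Set.Icc (0 : ℝ) 1) {P : ℝ → Prop} (hP : ∀ᵐ x ∂μ, P x)
    {A : ℝ} (hA : A < ∫ x, f x ∂μ) :
    ∀ᶠ n : ℕ in atTop, ∃ φ : ℝ → ℝ, UpperSemicontinuous φ ∧
      (∀ x, φ x ∈ Set.Icc 0 (1 - 1 / ((n : ℝ) + 1))) ∧ (∀ x, (n : ℝ) < |x| → φ x = 0) ∧
      (∀ x, 0 < φ x → φ x < f x ∧ P x) ∧ A < ∫ x, φ x ∂μ := by
  obtain ⟨D, hDP, hD, hDμ⟩ : ∃ D, D ⊆ {x | P x} ∧ MeasurableSet D ∧ ∀ᵐ x ∂μ, x ∈ D := by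
    obtain ⟨t, ht, htm, ht0⟩ := exists_measurable_superset_of_null hP
    exact ⟨tᶜ, Set.compl_subset_comm.1 ht, htm.compl, compl_mem_ae_iff.2 ht0⟩
  let F : ℕ → ℝ → ℝ≥0 := fun n => (D ∩ Set.Icc (-(n : ℝ)) n).indicator
    fun x => (f x - 1 / ((n : ℝ) + 1)).toNNReal
  have hFm : ∀ n, Measurable (F n) := fun n =>
    ((hf.sub_const _).real_toNNReal).indicator (hD.inter measurableSet_Icc)
  have hFle : ∀ n x, (F n x : ℝ) ≤ max (f x - 1 / ((n : ℝ) + 1)) 0 := fun n x => by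
    by_cases hx : x ∈ D ∩ Set.Icc (-(n : ℝ)) n
    · simp [F, Set.indicator_of_mem hx]
    · simp [F, Set.indicator_of_notMem hx]
  have hn : ∀ n : ℕ, 0 < 1 / ((n : ℝ) + 1) ∧ 1 / ((n : ℝ) + 1) ≤ 1 := fun n =>
    ⟨by positivity, by rw [div_le_one (by positivity)]; simp⟩
  have hFc : ∀ n x, (F n x : ℝ) ≤ 1 - 1 / ((n : ℝ) + 1) := fun n x =>
    (hFle n x).trans (max_le (by linarith [(hf01 x).2]) (by linarith [(hn n).2]))
  have hFi : ∀ n, Integrable (fun x => (F n x : ℝ)) μ := fun n =>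
    Integrable.of_mem_Icc 0 (1 - 1 / ((n : ℝ) + 1)) (hFm n).coe_nnreal_real.aemeasurable
      (ae_of_all _ fun x => ⟨(F n x).2, hFc n x⟩)
  have hlim : Tendsto (fun n => ∫ x, (F n x : ℝ) ∂μ) atTop (𝓝 (∫ x, f x ∂μ)) := by
    refine tendsto_integral_of_dominated_convergence (fun _ => 1)
      (fun n => (hFi n).aestronglyMeasurable) (integrable_const 1)
      (fun n => ae_of_all _ fun x => ?_) ?_
    · rw [Real.norm_eq_abs, NNReal.abs_eq]
      linarith [hFc n x, (hn n).1]
    · filter_upwards [hDμ] with x hx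
      have h1 : Tendsto (fun n : ℕ => max (f x - 1 / ((n : ℝ) + 1)) 0) atTop (𝓝 (f x)) := by
        have := ((tendsto_const_nhds (x := f x)).sub
          (tendsto_one_div_add_atTop_nhds_zero_nat (𝕜 := ℝ))).max
          (tendsto_const_nhds (x := (0 : ℝ)))
        simpa [(hf01 x).1] using this
      refine h1.congr' ?_
      filter_upwards [tendsto_natCast_atTop_atTop.eventually_ge_atTop |x|] with n hnx
      simp [F, Set.indicator_of_mem (show x ∈ D ∩ Set.Icc (-(n : ℝ)) n from ⟨hx, abs_le.1 hnx⟩)]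
  filter_upwards [hlim.eventually_const_lt hA] with n hnA
  obtain ⟨φ, hφF, hφ, -, hφI⟩ := exists_upperSemicontinuous_le_integral_le (F n) (hFi n)
    (half_pos (sub_pos.2 hnA))
  have hle : ∀ x, (φ x : ℝ) ≤ F n x := fun x => by exact_mod_cast hφF x
  refine ⟨fun x => φ x, fun x y hxy => ?_, fun x => ⟨(φ x).2, (hle x).trans (hFc n x)⟩,
    fun x hx => ?_, fun x hx => ⟨?_, ?_⟩, by linarith⟩
  · have hy : 0 ≤ y := (φ x).2.trans hxy.le
    lift y to ℝ≥0 using hy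
    filter_upwards [hφ x y (by exact_mod_cast hxy)] with z hz using by exact_mod_cast hz
  · refine le_antisymm ((hle x).trans_eq ?_) (φ x).2
    simp only [F]
    rw [Set.indicator_of_notMem fun h => hx.not_ge (abs_le.2 h.2), NNReal.coe_zero]
  · rcases lt_max_iff.1 (hx.trans_le ((hle x).trans (hFle n x))) with h | h
    · have := (hle x).trans (hFle n x)
      rw [max_eq_left h.le] at this
      linarith [(hn n).1]
    · exact absurd h (lt_irrefl _)
  · by_contra hPx
    have : F n x = 0 := Set.indicator_of_notMem (fun h => hPx (hDP h.1)) _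
    have h2 := hle x
    rw [this] at h2
    exact absurd hx (not_lt.2 h2)

theorem exists_lowerSemicontinuous_gt {μ : Measure ℝ} [IsProbabilityMeasure μ] {h : ℝ → ℝ}
    (hh : Measurable h) (hh01 : ∀ x, h x ∈ Set.Icc (0 : ℝ) 1) {η : ℝ} (hη : 0 < η) :
    ∃ ψ : ℝ → ℝ, LowerSemicontinuous ψ ∧ (∀ x, ψ x ∈ Set.Icc (0 : ℝ) 1) ∧
      (∀ x c, c ≤ h x → c < 1 → c < ψ x) ∧ ∫ x, ψ x ∂μ ≤ ∫ x, h x ∂μ + η := by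
  have hhi : Integrable h μ :=
    Integrable.of_mem_Icc 0 1 hh.aemeasurable (ae_of_all _ hh01)
  obtain ⟨g, hg, hgl, hgt, hgi, hgI⟩ := exists_lt_lowerSemicontinuous_integral_gt_nnreal
    (fun x => (h x).toNNReal)
    (hhi.congr (ae_of_all _ fun x => (Real.coe_toNNReal _ (hh01 x).1).symm)) hη
  have hlt : ∀ x y, 0 ≤ y → (y < (min (g x) 1).toReal ↔ ENNReal.ofReal y < g x ∧ y < 1) :=
    fun x y hy => by
      rw [← ENNReal.ofReal_lt_iff_lt_toReal hy (by simp), lt_min_iff, ENNReal.ofReal_lt_one]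
  have hψ01 : ∀ x, (min (g x) 1).toReal ∈ Set.Icc (0 : ℝ) 1 := fun x =>
    ⟨ENNReal.toReal_nonneg, ENNReal.toReal_le_of_le_ofReal zero_le_one (by simp)⟩
  have hψ : LowerSemicontinuous fun x => (min (g x) 1).toReal := fun x y hy => by
    rcases lt_or_ge y 0 with hy0 | hy0
    · exact Eventually.of_forall fun z => hy0.trans_le (hψ01 z).1
    · have hy' := (hlt x y hy0).1 hy
      filter_upwards [hgl x _ hy'.1] with z hz using (hlt z y hy0).2 ⟨hz, hy'.2⟩
  refine ⟨_, hψ, hψ01, fun x c hcx hc => ?_, ?_⟩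
  · rcases lt_or_ge c 0 with hc0 | hc0
    · exact hc0.trans_le (hψ01 x).1
    · exact (hlt x c hc0).2 ⟨(ENNReal.ofReal_le_ofReal hcx).trans_lt (hg x), hc⟩
  · simp only [Real.coe_toNNReal _ (hh01 _).1] at hgI
    refine (integral_mono_ae (Integrable.of_mem_Icc 0 1 hψ.measurable.aemeasurable
      (ae_of_all _ hψ01)) hgi ?_).trans hgI.le
    filter_upwards [hgt] with x hx
    exact ENNReal.toReal_mono hx.ne (min_le_left _ _)

theorem ehrhard_of_lt {v : ℝ≥0} (hv : v ≠ 0) {p Φ Ψ : ℝ → ℝ}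
    (hq : IsQuantilePair p Φ Ψ) (hp : ∀ s, HasDerivAt p (-(s / v) * p s) s) {f g h : ℝ → ℝ}
    (hf : Measurable f) (hg : Measurable g) (hh : Measurable h)
    (hf01 : ∀ x, f x ∈ Set.Icc (0 : ℝ) 1) (hg01 : ∀ x, g x ∈ Set.Icc (0 : ℝ) 1)
    (hh01 : ∀ x, h x ∈ Set.Icc (0 : ℝ) 1) {P Q : ℝ → Prop}
    (hP : ∀ᵐ x ∂gaussianReal 0 v, P x) (hQ : ∀ᵐ x ∂gaussianReal 0 v, Q x)
    (hfgh : ∀ x y, P x → Q y → ∀ a b, 0 < a → a < f x → 0 < b → b < g y →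
      Φ (Ψ a + Ψ b) ≤ h (x + y)) {A B : ℝ} (hA : 0 < A) (hAf : A < ∫ x, f x ∂gaussianReal 0 v)
    (hB : 0 < B) (hBg : B < ∫ x, g x ∂gaussianReal 0 v) :
    Φ (Ψ A + Ψ B) ≤ ∫ x, h x ∂gaussianReal 0 v := by
  refine le_of_forall_pos_le_add fun η hη => ?_
  obtain ⟨ψ, hψ, hψ01, hψh, hψI⟩ := exists_lowerSemicontinuous_gt (μ := gaussianReal 0 v) hh hh01 hη
  obtain ⟨n, ⟨⟨φ, hφ, hφ01, hφn, hφf, hφA⟩, γ, hγ, hγ01, hγn, hγg, hγB⟩, hn⟩ :=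
    ((exists_upperSemicontinuous_lt hf hf01 hP hAf).and
      (exists_upperSemicontinuous_lt hg hg01 hQ hBg) |>.and (eventually_gt_atTop 0)).exists
  have hc : 1 - 1 / ((n : ℝ) + 1) ∈ Set.Ioo (0 : ℝ) 1 := by
    have hn' : (0 : ℝ) < n := by exact_mod_cast hn
    constructor
    · rw [sub_pos, div_lt_one (by positivity)]
      linarith
    · have : 0 < 1 / ((n : ℝ) + 1) := by positivity
      linarith
  have hle1 : ∀ {θ : ℝ → ℝ}, UpperSemicontinuous θ →
      (∀ x, θ x ∈ Set.Icc 0 (1 - 1 / ((n : ℝ) + 1))) →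
        ∀ {C}, 0 < C → C < ∫ x, θ x ∂gaussianReal 0 v →
      Ψ C ≤ Ψ (∫ x, θ x ∂gaussianReal 0 v) := by
    intro θ hθ hθc C hC hCθ
    have h1 : ∫ x, θ x ∂gaussianReal 0 v < 1 := by
      refine lt_of_le_of_lt ?_ hc.2
      simpa using integral_mono (μ := gaussianReal 0 v)
        (Integrable.of_mem_Icc 0 _ hθ.measurable.aemeasurable
        (ae_of_all _ hθc)) (integrable_const (1 - 1 / ((n : ℝ) + 1))) fun x => (hθc x).2
    exact hq.strictMonoOn_quantile.monotoneOn ⟨hC, hCθ.trans h1⟩ ⟨hC.trans hCθ, h1⟩ hCθ.le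
  refine ((hq.strictMono.monotone (add_le_add (hle1 hφ hφ01 hA hφA) (hle1 hγ hγ01 hB hγB))).trans
    (ehrhard_of_bounded_support hv hq hp hφ hγ hψ hc hφ01 hγ01 hψ01 hφn hγn (fun x y hx hy => ?_)
      (hA.trans hφA) (hB.trans hγB))).trans hψI
  exact hψh _ _ (hfgh x y (hφf x hx).2 (hγg y hy).2 _ _ hx (hφf x hx).1 hy (hγg y hy).1)
    (hq.mem _).2

/-- The Ehrhard mean `Φ (Ψ x + Ψ y)`, extended to the boundary of the unit square. -/
def ehrhardMean (Φ Ψ : ℝ → ℝ) (x y : ℝ) : ℝ :=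
  if x = 0 ∨ y = 0 then 0 else if x = 1 ∨ y = 1 then 1 else Φ (Ψ x + Ψ y)

namespace IsQuantilePair

variable {p Φ Ψ : ℝ → ℝ}

theorem ehrhardMean_mem (hq : IsQuantilePair p Φ Ψ) (x y : ℝ) :
    ehrhardMean Φ Ψ x y ∈ Set.Icc (0 : ℝ) 1 := by
  unfold ehrhardMean
  split_ifs
  · simp
  · simp
  · exact Set.Ioo_subset_Icc_self (hq.mem _)

theorem le_ehrhardMean (hq : IsQuantilePair p Φ Ψ) {a b x y : ℝ} (ha : 0 < a) (hax : a < x)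
    (hx : x ≤ 1) (hb : 0 < b) (hby : b < y) (hy : y ≤ 1) :
    Φ (Ψ a + Ψ b) ≤ ehrhardMean Φ Ψ x y := by
  unfold ehrhardMean
  rw [if_neg (by rintro (h | h) <;> linarith)]
  split_ifs with h
  · exact (hq.mem _).2.le
  · rw [not_or] at h
    exact hq.strictMono.monotone (add_le_add
      (hq.strictMonoOn_quantile ⟨ha, hax.trans_le hx⟩ ⟨ha.trans hax, hx.lt_of_ne h.1⟩ hax).le
      (hq.strictMonoOn_quantile ⟨hb, hby.trans_le hy⟩ ⟨hb.trans hby, hy.lt_of_ne h.2⟩ hby).le)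

theorem measurable_ehrhardMean (hq : IsQuantilePair p Φ Ψ) {α : Type*} [MeasurableSpace α]
    {f g : α → ℝ} (hf : Measurable f) (hg : Measurable g) (hf01 : ∀ x, f x ∈ Set.Icc (0 : ℝ) 1)
    (hg01 : ∀ x, g x ∈ Set.Icc (0 : ℝ) 1) : Measurable fun x => ehrhardMean Φ Ψ (f x) (g x) := by
  have hΨ : Measurable ((Set.Ioo (0 : ℝ) 1).piecewise Ψ 0) :=
    ContinuousOn.measurable_piecewise (fun x hx => (hq.continuousAt_quantile hx).continuousWithinAt)
      continuousOn_const measurableSet_Ioo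
  have heq : (fun x => ehrhardMean Φ Ψ (f x) (g x)) = fun x =>
      if f x = 0 ∨ g x = 0 then 0 else if f x = 1 ∨ g x = 1 then 1 else
        Φ ((Set.Ioo (0 : ℝ) 1).piecewise Ψ 0 (f x) + (Set.Ioo (0 : ℝ) 1).piecewise Ψ 0 (g x)) := by
    ext x
    unfold ehrhardMean
    split_ifs with h0 h1
    · rfl
    · rfl
    · rw [not_or] at h0 h1
      have hfx : f x ∈ Set.Ioo (0 : ℝ) 1 := ⟨(hf01 x).1.lt_of_ne' h0.1, (hf01 x).2.lt_of_ne h1.1⟩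
      have hgx : g x ∈ Set.Ioo (0 : ℝ) 1 := ⟨(hg01 x).1.lt_of_ne' h0.2, (hg01 x).2.lt_of_ne h1.2⟩
      rw [Set.piecewise_eq_of_mem _ _ _ hfx, Set.piecewise_eq_of_mem _ _ _ hgx]
  rw [heq]
  exact Measurable.ite ((measurableSet_eq_fun hf measurable_const).union
    (measurableSet_eq_fun hg measurable_const)) measurable_const
    (Measurable.ite ((measurableSet_eq_fun hf measurable_const).union
      (measurableSet_eq_fun hg measurable_const)) measurable_const
      (hq.continuous.measurable.comp ((hΨ.comp hf).add (hΨ.comp hg))))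

end IsQuantilePair

/-- Almost every `x` is such that each superlevel set `{a < f}` with `a < f x` fills more than half
of all small balls around `x`. -/
theorem ae_eventually_lt_volume_inter_closedBall {f : ℝ → ℝ} (hf : Measurable f) :
    ∀ᵐ x, ∀ a < f x, ∀ᶠ r in 𝓝[>] (0 : ℝ),
      ENNReal.ofReal r < volume ({s | a < f s} ∩ Metric.closedBall x r) := by
  have h := ae_all_iff.2 fun q : ℚ =>
    Besicovitch.ae_tendsto_measure_inter_div_of_measurableSet (volume : Measure ℝ)
      (measurableSet_lt measurable_const hf : MeasurableSet {s | (q : ℝ) < f s})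
  filter_upwards [h] with x hx a ha
  obtain ⟨q, haq, hqx⟩ := exists_rat_btwn ha
  have h1 := hx q
  rw [Set.indicator_of_mem (show x ∈ {s | (q : ℝ) < f s} from hqx)] at h1
  filter_upwards [h1.eventually_const_lt (show (1 / 2 : ℝ≥0∞) < 1 by simp),
    self_mem_nhdsWithin] with r hr hr0
  rw [ENNReal.lt_div_iff_mul_lt (by simp) (by simp), Real.volume_closedBall] at hr
  refine lt_of_eq_of_lt ?_ (hr.trans_le (measure_mono (Set.inter_subset_inter_left _
    fun s hs => haq.trans hs)))
  rw [ENNReal.ofReal_mul zero_le_two, ← mul_assoc]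
  simp [ENNReal.inv_mul_cancel]

theorem volume_superlevel_pos {f g : ℝ → ℝ} (hf : Measurable f) (hg : Measurable g) {x y a b : ℝ}
    (hx : ∀ᶠ r in 𝓝[>] (0 : ℝ), ENNReal.ofReal r < volume ({s | a < f s} ∩ Metric.closedBall x r))
    (hy : ∀ᶠ r in 𝓝[>] (0 : ℝ), ENNReal.ofReal r < volume ({s | b < g s} ∩ Metric.closedBall y r)) :
    0 < volume {t | a < f (x + y - t) ∧ b < g t} := by
  obtain ⟨r, ⟨hrx, hry⟩, hr⟩ := ((hx.and hy).and self_mem_nhdsWithin).exists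
  have hr' : 0 < r := hr
  set S := (fun t => x + y - t) ⁻¹' ({s | a < f s} ∩ Metric.closedBall x r)
  set S' := {s | b < g s} ∩ Metric.closedBall y r
  have hS : volume S = volume ({s | a < f s} ∩ Metric.closedBall x r) :=
    (Measure.measurePreserving_sub_left volume (x + y)).measure_preimage
      ((measurableSet_lt measurable_const hf).inter measurableSet_closedBall).nullMeasurableSet
  have hS'm : MeasurableSet S' :=
    (measurableSet_lt measurable_const hg).inter measurableSet_closedBall
  have hsub : S ∪ S' ⊆ Metric.closedBall y r := by
    refine Set.union_subset (fun t ht => ?_) Set.inter_subset_right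
    have := ht.2
    rw [Metric.mem_closedBall, Real.dist_eq] at this ⊢
    rwa [abs_sub_comm, show y - t = x + y - t - x by ring]
  refine lt_of_lt_of_le ?_ (measure_mono (show S ∩ S' ⊆ _ from fun t ht => ⟨ht.1.1, ht.2.1⟩))
  rw [pos_iff_ne_zero]
  intro h0
  have h1 := measure_union_add_inter S hS'm (μ := volume)
  rw [h0, add_zero] at h1
  have h2 := measure_mono hsub (μ := volume)
  rw [h1, Real.volume_closedBall, two_mul, ENNReal.ofReal_add hr'.le hr'.le] at h2
  exact absurd h2 (not_le.2 (ENNReal.add_lt_add (hS ▸ hrx) hry))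

theorem lt_essSup_iff {α : Type*} [MeasurableSpace α] {μ : Measure α} [NeZero μ] {m M : ℝ}
    {f : α → ℝ} (hf : ∀ x, f x ∈ Set.Icc m M) (c : ℝ) :
    c < essSup f μ ↔ 0 < μ {x | c < f x} := by
  have hle : IsBoundedUnder (· ≤ ·) (ae μ) f := isBoundedUnder_of ⟨M, fun x => (hf x).2⟩
  have hge : IsBoundedUnder (· ≥ ·) (ae μ) f := isBoundedUnder_of ⟨m, fun x => (hf x).1⟩
  rw [← not_iff_not, not_lt, not_lt, nonpos_iff_eq_zero]
  have hiff : μ {x | c < f x} = 0 ↔ ∀ᵐ x ∂μ, f x ≤ c := by simp [ae_iff]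
  rw [hiff]
  exact ⟨fun h => (ae_le_essSup hle).mono fun x hx => hx.trans h,
    fun h => essSup_le_of_ae_le c h hge.isCoboundedUnder_le⟩

theorem essSup_mem_Icc {α : Type*} [MeasurableSpace α] {μ : Measure α} [NeZero μ] {m M : ℝ}
    {f : α → ℝ} (hf : ∀ x, f x ∈ Set.Icc m M) : essSup f μ ∈ Set.Icc m M := by
  constructor
  · refine le_of_forall_lt fun c hc => (lt_essSup_iff hf c).2 ?_
    have : {x | c < f x} = Set.univ := Set.eq_univ_of_forall fun x => hc.trans_le (hf x).1
    rw [this]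
    exact Measure.measure_univ_pos.2 (NeZero.ne μ)
  · refine not_lt.1 fun hM => ?_
    have : {x | M < f x} = ∅ := Set.eq_empty_of_forall_notMem fun x hx => not_lt.2 (hf x).2 hx
    rw [lt_essSup_iff hf, this] at hM
    simp at hM

theorem measurable_essSup_ehrhardMean {p Φ Ψ : ℝ → ℝ} (hq : IsQuantilePair p Φ Ψ) {f g : ℝ → ℝ}
    (hf : Measurable f) (hg : Measurable g) (hf01 : ∀ x, f x ∈ Set.Icc (0 : ℝ) 1)
    (hg01 : ∀ x, g x ∈ Set.Icc (0 : ℝ) 1) :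
    Measurable fun z => essSup (fun y => ehrhardMean Φ Ψ (f (z - y)) (g y)) volume := by
  have hm : Measurable fun q : ℝ × ℝ => ehrhardMean Φ Ψ (f (q.1 - q.2)) (g q.2) :=
    hq.measurable_ehrhardMean (hf.comp (measurable_fst.sub measurable_snd))
      (hg.comp measurable_snd) (fun _ => hf01 _) fun _ => hg01 _
  refine measurable_of_Ioi fun c => ?_
  have : (fun z => essSup (fun y => ehrhardMean Φ Ψ (f (z - y)) (g y)) volume) ⁻¹' Set.Ioi c
      = {z | 0 < volume (Prod.mk z ⁻¹'
          {q : ℝ × ℝ | c < ehrhardMean Φ Ψ (f (q.1 - q.2)) (g q.2)})} := by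
    ext z
    exact lt_essSup_iff (fun y => hq.ehrhardMean_mem (f (z - y)) (g y)) c
  rw [this]
  exact measurableSet_lt measurable_const
    (measurable_measure_prodMk_left (measurableSet_lt measurable_const hm))

/-- The functional Ehrhard inequality on the line. -/
theorem ehrhard_real {v : ℝ≥0} (hv : v ≠ 0) {p Φ Ψ : ℝ → ℝ} (hq : IsQuantilePair p Φ Ψ)
    (hp : ∀ s, HasDerivAt p (-(s / v) * p s) s) {f g : ℝ → ℝ} (hf : Measurable f)
    (hg : Measurable g) (hf01 : ∀ x, f x ∈ Set.Icc (0 : ℝ) 1)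
    (hg01 : ∀ x, g x ∈ Set.Icc (0 : ℝ) 1) :
    ehrhardMean Φ Ψ (∫ x, f x ∂gaussianReal 0 v) (∫ x, g x ∂gaussianReal 0 v) ≤
      ∫ z, essSup (fun y => ehrhardMean Φ Ψ (f (z - y)) (g y)) volume ∂gaussianReal 0 v := by
  set μ := gaussianReal 0 v
  set h : ℝ → ℝ := fun z => essSup (fun y => ehrhardMean Φ Ψ (f (z - y)) (g y)) volume
  have hh01 : ∀ z, h z ∈ Set.Icc (0 : ℝ) 1 := fun z =>
    essSup_mem_Icc fun y => hq.ehrhardMean_mem _ _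
  have key : ∀ {A B : ℝ}, 0 < A → A < ∫ x, f x ∂μ → 0 < B → B < ∫ x, g x ∂μ →
      Φ (Ψ A + Ψ B) ≤ ∫ z, h z ∂μ := by
    intro A B hA hAf hB hBg
    refine ehrhard_of_lt hv hq hp hf hg (measurable_essSup_ehrhardMean hq hf hg hf01 hg01)
      hf01 hg01 hh01
      ((gaussianReal_absolutelyContinuous 0 hv).ae_le (ae_eventually_lt_volume_inter_closedBall hf))
      ((gaussianReal_absolutelyContinuous 0 hv).ae_le (ae_eventually_lt_volume_inter_closedBall hg))
      (fun x y hx hy a b ha hax hb hby => le_of_forall_lt fun c hc => ?_) hA hAf hB hBg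
    rw [lt_essSup_iff fun y => hq.ehrhardMean_mem _ _]
    exact (volume_superlevel_pos hf hg (hx a hax) (hy b hby)).trans_le (measure_mono fun t ht =>
      hc.trans_le (hq.le_ehrhardMean ha ht.1 (hf01 _).2 hb ht.2 (hg01 _).2))
  have mean_mem : ∀ {θ : ℝ → ℝ}, (∀ x, θ x ∈ Set.Icc (0 : ℝ) 1) → ∫ x, θ x ∂μ ∈ Set.Icc (0 : ℝ) 1 :=
    fun {θ} hθ => ⟨integral_nonneg fun x => (hθ x).1, by
      simpa using integral_mono_of_nonneg (ae_of_all μ fun x => (hθ x).1) (integrable_const (1 : ℝ))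
        (ae_of_all _ fun x => (hθ x).2)⟩
  have hone : ∀ {B : ℝ}, 0 < B → (∀ A, 0 < A → A < 1 → Φ (Ψ A + Ψ B) ≤ ∫ z, h z ∂μ) →
      1 ≤ ∫ z, h z ∂μ := fun {B} hB hAB => le_of_forall_lt fun c hc => by
    obtain ⟨s, hs⟩ := hq.exists_lt_apply hc
    have := hAB _ (hq.mem (s - Ψ B)).1 (hq.mem (s - Ψ B)).2
    rw [hq.quantile_apply, sub_add_cancel] at this
    exact hs.trans_le this
  have hfI := mean_mem hf01
  have hgI := mean_mem hg01
  unfold ehrhardMean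
  split_ifs with h0 h1
  · exact (mean_mem hh01).1
  · rw [not_or] at h0
    have hf0 := hfI.1.lt_of_ne' h0.1
    have hg0 := hgI.1.lt_of_ne' h0.2
    rcases h1 with h1 | h1
    · exact hone (half_pos hg0) fun A hA hA1 => key hA (hA1.trans_eq h1.symm) (half_pos hg0)
        (half_lt_self hg0)
    · refine hone (half_pos hf0) fun B hB hB1 => ?_
      rw [add_comm]
      exact key (half_pos hf0) (half_lt_self hf0) hB (hB1.trans_eq h1.symm)
  · rw [not_or] at h0 h1
    have hf0 : ∫ x, f x ∂μ ∈ Set.Ioo (0 : ℝ) 1 := ⟨hfI.1.lt_of_ne' h0.1, hfI.2.lt_of_ne h1.1⟩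
    have hg0 : ∫ x, g x ∂μ ∈ Set.Ioo (0 : ℝ) 1 := ⟨hgI.1.lt_of_ne' h0.2, hgI.2.lt_of_ne h1.2⟩
    have c1 : Tendsto (fun κ => Ψ (∫ x, f x ∂μ - κ)) (𝓝[>] 0) (𝓝 (Ψ (∫ x, f x ∂μ))) :=
      (hq.continuousAt_quantile hf0).tendsto.comp (tendsto_nhdsWithin_of_tendsto_nhds
        (by simpa using tendsto_const_nhds.sub (tendsto_id (x := 𝓝 (0 : ℝ)))))
    have c2 : Tendsto (fun κ => Ψ (∫ x, g x ∂μ - κ)) (𝓝[>] 0) (𝓝 (Ψ (∫ x, g x ∂μ))) :=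
      (hq.continuousAt_quantile hg0).tendsto.comp (tendsto_nhdsWithin_of_tendsto_nhds
        (by simpa using tendsto_const_nhds.sub (tendsto_id (x := 𝓝 (0 : ℝ)))))
    refine le_of_tendsto ((hq.continuous.tendsto _).comp (c1.add c2)) ?_
    filter_upwards [Ioo_mem_nhdsGT hf0.1, Ioo_mem_nhdsGT hg0.1] with κ h1 h2
    exact key (by linarith [h1.2]) (by linarith [h1.1]) (by linarith [h2.2]) (by linarith [h1.1])

theorem sq_eq_two_of_conv_self {μ : Measure ℝ} [IsProbabilityMeasure μ]
    (hμ1 : Integrable (fun x => x) μ) (hμ2 : Integrable (fun x => x ^ 2) μ) (h0 : ∫ x, x ∂μ = 0)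
    (hσ : 0 < ∫ x, x ^ 2 ∂μ) {c : ℝ} (h : μ ∗ μ = μ.map (c * ·)) : c ^ 2 = 2 := by
  have hm : AEMeasurable (c * ·) μ := by fun_prop
  have hsq : AEStronglyMeasurable (fun z : ℝ => z ^ 2) (μ.map (c * ·)) :=
    (continuous_id.pow 2).aestronglyMeasurable
  have hi : Integrable (fun z : ℝ => z ^ 2) (μ ∗ μ) := by
    rw [h, integrable_map_measure hsq hm]
    exact (hμ2.const_mul (c ^ 2)).congr (ae_of_all _ fun x => by simp [mul_pow])
  have h1 : ∫ z, z ^ 2 ∂(μ ∗ μ) = c ^ 2 * ∫ x, x ^ 2 ∂μ := by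
    rw [h, integral_map hm hsq, ← integral_const_mul]
    simp_rw [mul_pow]
  have h2 (x : ℝ) : ∫ y, (x + y) ^ 2 ∂μ = x ^ 2 + ∫ y, y ^ 2 ∂μ := by
    have e : (fun y : ℝ => (x + y) ^ 2) = fun y => x ^ 2 + (2 * x * y + y ^ 2) := by ext y; ring
    have i1 := hμ1.const_mul (2 * x)
    have i2 : Integrable (fun y => 2 * x * y + y ^ 2) μ := i1.add hμ2
    rw [e, integral_add (integrable_const _) i2, integral_add i1 hμ2, integral_const_mul, h0]
    simp
  rw [integral_conv hi] at h1
  simp_rw [h2] at h1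
  rw [integral_add hμ2 (integrable_const _)] at h1
  simp only [integral_const, probReal_univ, smul_eq_mul, one_mul] at h1
  nlinarith [mul_right_cancel₀ hσ.ne' (show c ^ 2 * ∫ x, x ^ 2 ∂μ = 2 * ∫ x, x ^ 2 ∂μ by linarith)]

/-- A centred law of finite variance which is stable under self-convolution is Gaussian. -/
theorem eq_gaussianReal_of_conv_self {μ : Measure ℝ} [IsProbabilityMeasure μ]
    (hμ1 : Integrable (fun x => x) μ) (hμ2 : Integrable (fun x => x ^ 2) μ) (h0 : ∫ x, x ∂μ = 0)
    (hσ : 0 < ∫ x, x ^ 2 ∂μ) {c : ℝ} (hc : 0 < c) (h : μ ∗ μ = μ.map (c * ·)) :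
    μ = gaussianReal 0 (∫ x, x ^ 2 ∂μ).toNNReal := by
  have hc2 := sq_eq_two_of_conv_self hμ1 hμ2 h0 hσ h
  set s := √(∫ x, x ^ 2 ∂μ) with hs
  have hs0 : 0 < s := Real.sqrt_pos.2 hσ
  have hs2 : s ^ 2 = ∫ x, x ^ 2 ∂μ := Real.sq_sqrt hσ.le
  have hφ (t : ℝ) : charFun (μ.map (s⁻¹ * ·)) t ^ 2 = charFun (μ.map (s⁻¹ * ·)) (c * t) := by
    rw [charFun_map_mul, charFun_map_mul, sq, ← charFun_conv, h, charFun_map_mul]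
    ring_nf
  have hpow (n : ℕ) (t : ℝ) : charFun (μ.map (s⁻¹ * ·)) t ^ 2 ^ n =
      charFun (μ.map (s⁻¹ * ·)) (c ^ n * t) := by
    induction n generalizing t with
    | zero => simp
    | succ n ih => rw [pow_succ, pow_mul, ih, hφ, ← mul_assoc, ← pow_succ']
  have hlim (t : ℝ) : charFun (μ.map (s⁻¹ * ·)) t = Complex.exp (-t ^ 2 / 2) := by
    have hX0 : ∫ x, s⁻¹ * x ∂μ = 0 := by rw [integral_const_mul, h0, mul_zero]
    have hX1 : ∫ x, ((s⁻¹ * ·) ^ 2 : ℝ → ℝ) x ∂μ = 1 := by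
      simp only [Pi.pow_apply, mul_pow]
      rw [integral_const_mul, ← hs2, ← mul_pow, inv_mul_cancel₀ hs0.ne', one_pow]
    have := (tendsto_charFun_inv_sqrt_mul_pow (by fun_prop) hX0 hX1 t).comp
      (tendsto_pow_atTop_atTop_of_one_lt (one_lt_two (α := ℕ)))
    refine tendsto_nhds_unique (tendsto_const_nhds.congr fun n => ?_) this
    have hcn : √((2 ^ n : ℕ) : ℝ) = c ^ n := by
      push_cast
      rw [← hc2, ← pow_mul, mul_comm, pow_mul, Real.sqrt_sq (by positivity)]
    simp only [Function.comp_apply]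
    rw [hpow, hcn, mul_inv_cancel_left₀ (by positivity)]
  refine Measure.ext_of_charFun (funext fun t => ?_)
  have := hlim (s * t)
  rw [charFun_map_mul, inv_mul_cancel_left₀ hs0.ne'] at this
  rw [this, charFun_gaussianReal, Real.coe_toNNReal _ hσ.le, ← hs2]
  push_cast
  ring_nf

theorem gaussianReal_eq_withDensity_exp {v : ℝ≥0} (hv : v ≠ 0) :
    gaussianReal 0 v = volume.withDensity fun x =>
      ENNReal.ofReal (exp (-((2 * (v : ℝ))⁻¹ * x ^ 2) + Real.log (√(2 * π * v))⁻¹)) := by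
  rw [gaussianReal_of_var_ne_zero _ hv]
  congr 1 with x
  have hv' : (0 : ℝ) < v := by positivity
  rw [gaussianPDF, gaussianPDFReal, Real.exp_add, Real.exp_log (by positivity), mul_comm]
  congr 3
  simp
  ring

theorem exp_eq_of_withDensity_eq {p q : ℝ → ℝ} (hp : Continuous p) (hq : Continuous q)
    (hp0 : ∀ x, 0 ≤ p x) (hq0 : ∀ x, 0 ≤ q x)
    (h : (volume.withDensity fun x => ENNReal.ofReal (p x)) =
      volume.withDensity fun x => ENNReal.ofReal (q x)) : p = q := by
  rw [withDensity_eq_iff_of_sigmaFinite (by fun_prop) (by fun_prop)] at h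
  refine (Continuous.ae_eq_iff_eq volume hp hq).1 ?_
  filter_upwards [h] with x hx
  exact (ENNReal.ofReal_eq_ofReal_iff (hp0 x) (hq0 x)).1 hx

section Shift

variable {p Φ Ψ : ℝ → ℝ} {μ : Measure ℝ} [IsProbabilityMeasure μ]

theorem apply_neg_of_map_neg [NullSingletonClass μ] (hΦ : ∀ s, Φ s = (μ (Set.Iic s)).toReal)
    (heven : μ.map (fun x : ℝ => -x) = μ) (s : ℝ) : Φ (-s) = 1 - Φ s := by
  have h1 : μ (Set.Iic (-s)) = μ (Set.Iic s)ᶜ := by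
    nth_rw 1 [← heven]
    rw [Measure.map_apply measurable_neg measurableSet_Iic, Set.compl_Iic]
    simp only [Set.neg_preimage, Set.neg_Iic, neg_neg]
    exact measure_congr Ioi_ae_eq_Ici.symm
  rw [hΦ, hΦ, h1]
  exact probReal_compl_eq_one_sub measurableSet_Iic

namespace IsQuantilePair

theorem integrable_shift (hq : IsQuantilePair p Φ Ψ) (β : ℝ) :
    Integrable (fun x => Φ (x + β)) μ :=
  .of_bound (hq.continuous.comp (continuous_add_const β)).aestronglyMeasurable 1
    (ae_of_all _ fun x => by
      rw [Real.norm_of_nonneg (hq.mem _).1.le]; exact (hq.mem _).2.le)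

theorem integral_shift_mem (hq : IsQuantilePair p Φ Ψ) (β : ℝ) :
    ∫ x, Φ (x + β) ∂μ ∈ Set.Ioo (0 : ℝ) 1 :=
  integral_mem_Ioo_zero_one (hq.integrable_shift β).aestronglyMeasurable
    fun _ => hq.mem _

theorem continuous_integral_shift (hq : IsQuantilePair p Φ Ψ) :
    Continuous fun β => ∫ x, Φ (x + β) ∂μ := by
  refine continuous_of_dominated (bound := fun _ => 1)
    (fun β => (hq.integrable_shift β).aestronglyMeasurable) (fun β => ae_of_all _ fun x => ?_)
    (integrable_const _) (ae_of_all _ fun x => hq.continuous.comp (continuous_const_add x))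
  rw [Real.norm_of_nonneg (hq.mem _).1.le]; exact (hq.mem _).2.le

theorem integral_shift_strictMono (hq : IsQuantilePair p Φ Ψ) :
    StrictMono fun β => ∫ x, Φ (x + β) ∂μ := fun β γ hβγ => by
  have hpos (x : ℝ) : 0 < Φ (x + γ) - Φ (x + β) :=
    sub_pos.2 (hq.strictMono (by linarith))
  have : 0 < ∫ x, (Φ (x + γ) - Φ (x + β)) ∂μ := by
    rw [integral_pos_iff_support_of_nonneg (fun x => (hpos x).le)
      ((hq.integrable_shift γ).sub (hq.integrable_shift β)),
      Function.support_eq_univ fun x => (hpos x).ne']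
    simp
  rw [integral_sub (hq.integrable_shift γ) (hq.integrable_shift β)] at this
  exact sub_pos.1 this

theorem integral_shift_neg (hq : IsQuantilePair p Φ Ψ) [NullSingletonClass μ]
    (hΦ : ∀ s, Φ s = (μ (Set.Iic s)).toReal) (heven : μ.map (fun x : ℝ => -x) = μ) (β : ℝ) :
    ∫ x, Φ (x + -β) ∂μ = 1 - ∫ x, Φ (x + β) ∂μ := by
  have h1 : ∫ x, Φ (x + -β) ∂μ = ∫ x, Φ (-x + -β) ∂μ := by
    nth_rw 1 [← heven]
    exact integral_map measurable_neg.aemeasurable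
      (hq.continuous.comp (continuous_add_const _)).aestronglyMeasurable
  rw [h1]
  have h2 (x : ℝ) : Φ (-x + -β) = 1 - Φ (x + β) := by
    rw [← neg_add, apply_neg_of_map_neg hΦ heven]
  simp_rw [h2]
  rw [integral_sub (integrable_const _) (hq.integrable_shift β)]
  simp

theorem quantile_one_sub (hq : IsQuantilePair p Φ Ψ) (hneg : ∀ s, Φ (-s) = 1 - Φ s) {x : ℝ}
    (hx : x ∈ Set.Ioo (0 : ℝ) 1) : Ψ (1 - x) = -Ψ x := by
  rw [← hq.quantile_apply (-Ψ x), hneg, hq.apply_quantile x hx]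

/-- Oddness turns a weighted superadditivity of the shifted quantiles into linearity. -/
theorem exists_integral_shift_eq (hq : IsQuantilePair p Φ Ψ) [NullSingletonClass μ]
    (hΦ : ∀ s, Φ s = (μ (Set.Iic s)).toReal) (heven : μ.map (fun x : ℝ => -x) = μ)
    {a b : ℝ} (ha : 0 < a) (hb : 0 < b)
    (h : ∀ β γ, a * Ψ (∫ x, Φ (x + β) ∂μ) + b * Ψ (∫ x, Φ (x + γ) ∂μ) ≤
      Ψ (∫ x, Φ (x + (a * β + b * γ)) ∂μ)) :
    ∃ k > 0, ∀ β, ∫ x, Φ (x + β) ∂μ = Φ (k * β) := by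
  set θ : ℝ → ℝ := fun β => Ψ (∫ x, Φ (x + β) ∂μ) with hθ
  have hneg := apply_neg_of_map_neg hΦ heven
  have hodd (β : ℝ) : θ (-β) = -θ β := by
    simp only [hθ]
    rw [hq.integral_shift_neg hΦ heven, hq.quantile_one_sub hneg (hq.integral_shift_mem β)]
  have h0 : θ 0 = 0 := by have := hodd 0; rw [neg_zero] at this; linarith
  have heq (β γ : ℝ) : θ (a * β + b * γ) = a * θ β + b * θ γ := by
    refine le_antisymm ?_ (h β γ)
    have := h (-β) (-γ)
    change a * θ (-β) + b * θ (-γ) ≤ θ (a * -β + b * -γ) at this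
    rw [show a * -β + b * -γ = -(a * β + b * γ) by ring, hodd, hodd, hodd] at this
    linarith
  have hadd (x y : ℝ) : θ (x + y) = θ x + θ y := by
    have h1 := heq (x / a) 0
    have h2 := heq 0 (y / b)
    have h3 := heq (x / a) (y / b)
    rw [mul_div_cancel₀ _ ha.ne', mul_zero, add_zero, h0, mul_zero, add_zero] at h1
    rw [mul_div_cancel₀ _ hb.ne', mul_zero, zero_add, h0, mul_zero, zero_add] at h2
    rw [mul_div_cancel₀ _ ha.ne', mul_div_cancel₀ _ hb.ne', ← h1, ← h2] at h3
    exact h3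
  have hcont : Continuous θ := continuous_iff_continuousAt.2 fun β =>
    (hq.continuousAt_quantile (hq.integral_shift_mem β)).comp_of_eq
      hq.continuous_integral_shift.continuousAt rfl
  have hlin (β : ℝ) : θ β = θ 1 * β := by
    have := ((⟨⟨θ, h0⟩, hadd⟩ : ℝ →+ ℝ).toRealLinearMap hcont).map_smul β 1
    simpa [mul_comm] using this
  refine ⟨θ 1, ?_, fun β => ?_⟩
  · rw [← h0]
    exact hq.strictMonoOn_quantile (hq.integral_shift_mem _) (hq.integral_shift_mem _)
      (hq.integral_shift_strictMono one_pos)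
  · rw [← hlin, hq.apply_quantile _ (hq.integral_shift_mem β)]

end IsQuantilePair

theorem conv_self_Iic (hm : Measurable Φ) (hΦ : ∀ s, Φ s = (μ (Set.Iic s)).toReal)
    (heven : μ.map (fun x : ℝ => -x) = μ) (β : ℝ) :
    (μ ∗ μ) (Set.Iic β) = ENNReal.ofReal (∫ x, Φ (x + β) ∂μ) := by
  have hΦ' (s : ℝ) : μ (Set.Iic s) = ENNReal.ofReal (Φ s) := by
    rw [hΦ, ENNReal.ofReal_toReal (measure_ne_top _ _)]
  have hs (x : ℝ) : ∫⁻ y, (Set.Iic β).indicator 1 (x + y) ∂μ = ENNReal.ofReal (Φ (β - x)) := by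
    rw [← hΦ', ← lintegral_indicator_one measurableSet_Iic]
    refine lintegral_congr fun y => ?_
    simp only [Set.indicator, Set.mem_Iic, le_sub_iff_add_le']
    rfl
  rw [← lintegral_indicator_one measurableSet_Iic,
    Measure.lintegral_conv (measurable_one.indicator measurableSet_Iic)]
  simp_rw [hs]
  rw [← heven, lintegral_map (by fun_prop) measurable_neg, heven,
    ofReal_integral_eq_lintegral_ofReal]
  · exact lintegral_congr fun x => by rw [sub_neg_eq_add, add_comm]
  · refine .of_bound (hm.comp (measurable_add_const β)).aestronglyMeasurable 1
      (ae_of_all _ fun x => ?_)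
    rw [hΦ, Real.norm_of_nonneg ENNReal.toReal_nonneg]
    exact measureReal_le_one
  · exact ae_of_all _ fun x => ENNReal.toReal_nonneg.trans_eq (hΦ (x + β)).symm

theorem conv_self_eq_map {k : ℝ} (hk : 0 < k) (hm : Measurable Φ)
    (hΦ : ∀ s, Φ s = (μ (Set.Iic s)).toReal) (heven : μ.map (fun x : ℝ => -x) = μ)
    (h : ∀ β, ∫ x, Φ (x + β) ∂μ = Φ (k * β)) : μ ∗ μ = μ.map (k⁻¹ * ·) := by
  refine Measure.ext_of_Iic _ _ fun β => ?_
  rw [conv_self_Iic hm hΦ heven, h, hΦ, ENNReal.ofReal_toReal (measure_ne_top _ _),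
    Measure.map_apply (by fun_prop) measurableSet_Iic]
  congr 1 with x
  simp [inv_mul_le_iff₀ hk]

end Shift

theorem gaussianReal_of_exp {V : ℝ → ℝ} {μ : Measure ℝ} [IsProbabilityMeasure μ]
    (hμ : μ = volume.withDensity fun x => ENNReal.ofReal (exp (-V x))) {c d : ℝ} (hc : 0 < c)
    (h : ∀ x, exp (-V x) = exp (-(c * x ^ 2) + d)) :
    μ = gaussianReal 0 (2 * c)⁻¹.toNNReal := by
  have hv : (2 * c)⁻¹.toNNReal ≠ 0 := (Real.toNNReal_pos.2 (by positivity)).ne'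
  have hg := gaussianReal_eq_withDensity_exp hv
  set e := Real.log (√(2 * π * (2 * c)⁻¹.toNNReal))⁻¹
  have hcc : (2 * ((2 * c)⁻¹.toNNReal : ℝ))⁻¹ = c := by
    rw [Real.coe_toNNReal _ (by positivity)]; field_simp
  rw [hcc] at hg
  have hmul : μ = ENNReal.ofReal (exp (d - e)) • gaussianReal 0 (2 * c)⁻¹.toNNReal := by
    rw [hg, ← withDensity_smul _ (by fun_prop), hμ]
    congr 1 with x
    rw [Pi.smul_apply, smul_eq_mul, ← ENNReal.ofReal_mul (exp_nonneg _), h, ← Real.exp_add]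
    ring_nf
  have h1 : ENNReal.ofReal (exp (d - e)) = 1 := by
    have := congrArg (fun ν : Measure ℝ => ν Set.univ) hmul
    simpa using this.symm
  rw [hmul, h1, one_smul]

theorem starIneq1_gaussianReal {v : ℝ≥0} (hv : v ≠ 0) {p Φ Ψ : ℝ → ℝ}
    (hq : IsQuantilePair p Φ Ψ) (hp : ∀ s, HasDerivAt p (-(s / v) * p s) s) {H : ℝ × ℝ → ℝ}
    (hH : ∀ x y, H (x, y) = ehrhardMean Φ Ψ x y) :
    StarIneq1 1 1 (Set.Icc ((0 : ℝ), (0 : ℝ)) (1, 1)) H (gaussianReal 0 v) :=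
  fun f g hf hg hfg => by
  simp only [Set.mem_Icc, Prod.mk_le_mk] at hfg
  simp only [hH, div_one]
  exact ehrhard_real hv hq hp hf hg (fun x => ⟨(hfg x x).1.1, (hfg x x).2.1⟩)
    fun x => ⟨(hfg x x).1.2, (hfg x x).2.2⟩

theorem shift_le_of_starIneq1 {p Φ Ψ : ℝ → ℝ} {μ : Measure ℝ} [IsProbabilityMeasure μ]
    (hq : IsQuantilePair p Φ Ψ) {a b : ℝ} (ha : 0 < a) (hb : 0 < b) {H : ℝ × ℝ → ℝ}
    (hH : ∀ x ∈ Set.Ioo (0 : ℝ) 1, ∀ y ∈ Set.Ioo (0 : ℝ) 1,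
      H (x, y) = Φ (a * Ψ x + b * Ψ y))
    (h : StarIneq1 a b (Set.Icc ((0 : ℝ), (0 : ℝ)) (1, 1)) H μ) (β γ : ℝ) :
    a * Ψ (∫ x, Φ (x + β) ∂μ) + b * Ψ (∫ x, Φ (x + γ) ∂μ) ≤
      Ψ (∫ x, Φ (x + (a * β + b * γ)) ∂μ) := by
  have h1 := h (fun x => Φ (x + β)) (fun x => Φ (x + γ))
    (hq.continuous.comp (continuous_add_const β)).measurable
    (hq.continuous.comp (continuous_add_const γ)).measurable fun x y =>
      ⟨⟨(hq.mem _).1.le, (hq.mem _).1.le⟩, ⟨(hq.mem _).2.le, (hq.mem _).2.le⟩⟩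
  rw [hH _ (hq.integral_shift_mem β) _ (hq.integral_shift_mem γ)] at h1
  have h2 (x y : ℝ) : H (Φ ((x - y) / a + β), Φ (y / b + γ)) = Φ (x + (a * β + b * γ)) := by
    rw [hH _ (hq.mem _) _ (hq.mem _), hq.quantile_apply, hq.quantile_apply]
    congr 1
    field_simp
    ring
  simp only [h2, essSup_const'] at h1
  rwa [← hq.strictMono.le_iff_le, hq.apply_quantile _ (hq.integral_shift_mem _)]

theorem integrable_pow_of_integrable_abs_pow {μ : Measure ℝ} [IsFiniteMeasure μ] {m n : ℕ}
    (hmn : m ≤ n) (h : Integrable (fun t => |t| ^ n) μ) : Integrable (fun t => t ^ m) μ := by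
  refine ((integrable_const 1).add h).mono' (by fun_prop) (ae_of_all _ fun t => ?_)
  rw [norm_pow, Real.norm_eq_abs, Pi.add_apply]
  rcases le_total |t| 1 with ht | ht
  · linarith [pow_le_one₀ (n := m) (abs_nonneg t) ht, pow_nonneg (abs_nonneg t) n]
  · linarith [pow_le_pow_right₀ ht hmn]

theorem integral_id_eq_zero_of_map_neg {μ : Measure ℝ} (h : μ.map (fun x : ℝ => -x) = μ) :
    ∫ x, x ∂μ = 0 := by
  have : ∫ x, x ∂μ = ∫ x, -x ∂μ := by
    nth_rw 1 [← h]
    exact integral_map measurable_neg.aemeasurable aestronglyMeasurable_id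
  rw [integral_neg] at this
  linarith

theorem integral_sq_pos {μ : Measure ℝ} [IsProbabilityMeasure μ] [NullSingletonClass μ]
    (h : Integrable (fun t => t ^ 2) μ) : 0 < ∫ x, x ^ 2 ∂μ := by
  rw [integral_pos_iff_support_of_nonneg (fun x => sq_nonneg x) h]
  have : Function.support (fun x : ℝ => x ^ 2) = {0}ᶜ := by ext; simp
  rw [this, prob_compl_eq_one_sub (measurableSet_singleton 0), measure_singleton]
  simp

/-- in the class of even probability measures on the real line, the only
measures satisfying the functional Ehrhard inequality with their own distribution
function are the centered Gaussian measures. -/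
theorem stmt10 (V : ℝ → ℝ) (hV : ContDiff ℝ 2 fun x => Real.exp (-V x))
    (μ : Measure ℝ)
    (hμ : μ = volume.withDensity fun x => ENNReal.ofReal (Real.exp (-V x)))
    (hprob : IsProbabilityMeasure μ)
    (heven : μ.map (fun x : ℝ => -x) = μ)
    (hmom : Integrable (fun t => |t| ^ 5) μ)
    (Φ : ℝ → ℝ) (hΦ : ∀ s, Φ s = (μ (Set.Iic s)).toReal)
    (Φi : ℝ → ℝ) (hΦi : ∀ x ∈ Set.Ioo (0 : ℝ) 1, Φ (Φi x) = x)
    (Hab : ℝ → ℝ → ℝ × ℝ → ℝ)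
    (hHab : ∀ a b x y : ℝ, Hab a b (x, y) =
      if x = 0 ∨ y = 0 then 0
      else if x = 1 ∨ y = 1 then 1
      else Φ (a * Φi x + b * Φi y)) :
    (∃ a b : ℝ, 0 < a ∧ 0 < b ∧
        StarIneq1 a b (Set.Icc ((0 : ℝ), (0 : ℝ)) (1, 1)) (Hab a b) μ) ↔
      (∃ c d : ℝ, 0 < c ∧
        ∀ x : ℝ, Real.exp (-V x) = Real.exp (-(c * x ^ 2) + d)) := by
  have hcont : Continuous fun x => exp (-V x) := hV.continuous
  have hq : IsQuantilePair (fun x => exp (-V x)) Φ Φi :=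
    isQuantilePair_of_withDensity hcont (fun _ => exp_pos _) hμ hΦ hΦi
  have hac : μ ≪ volume := hμ ▸ withDensity_absolutelyContinuous _ _
  have : NullSingletonClass μ := ⟨fun x => hac (measure_singleton x)⟩
  constructor
  · rintro ⟨a, b, ha, hb, h⟩
    have hH : ∀ x ∈ Set.Ioo (0 : ℝ) 1, ∀ y ∈ Set.Ioo (0 : ℝ) 1,
        Hab a b (x, y) = Φ (a * Φi x + b * Φi y) := fun x hx y hy => by
      rw [hHab, if_neg (not_or.2 ⟨hx.1.ne', hy.1.ne'⟩), if_neg (not_or.2 ⟨hx.2.ne, hy.2.ne⟩)]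
    obtain ⟨k, hk, hkΦ⟩ := hq.exists_integral_shift_eq hΦ heven ha hb
      (shift_le_of_starIneq1 hq ha hb hH h)
    have hconv := conv_self_eq_map hk hq.continuous.measurable hΦ heven hkΦ
    have hμ2 := integrable_pow_of_integrable_abs_pow (m := 2) (by norm_num) hmom
    have hσ := integral_sq_pos hμ2
    have hgauss := eq_gaussianReal_of_conv_self
      (by simpa using integrable_pow_of_integrable_abs_pow (m := 1) (by norm_num) hmom)
      hμ2 (integral_id_eq_zero_of_map_neg heven) hσ (inv_pos.2 hk) hconv
    have hv : (∫ x, x ^ 2 ∂μ).toNNReal ≠ 0 := (Real.toNNReal_pos.2 hσ).ne'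
    have hv' : (0 : ℝ) < (∫ x, x ^ 2 ∂μ).toNNReal := by positivity
    refine ⟨_, _, ?_, congrFun (exp_eq_of_withDensity_eq hcont ?_ (fun _ => exp_nonneg _)
      (fun _ => exp_nonneg _)
      (hμ.symm.trans (hgauss.trans (gaussianReal_eq_withDensity_exp hv))))⟩
    · positivity
    · fun_prop
  · rintro ⟨c, d, hc, h⟩
    refine ⟨1, 1, one_pos, one_pos, ?_⟩
    rw [gaussianReal_of_exp hμ hc h]
    refine starIneq1_gaussianReal (Real.toNNReal_pos.2 (by positivity)).ne' hq (fun s => ?_)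
      fun x y => by rw [hHab, ehrhardMean, one_mul, one_mul]
    have hd : HasDerivAt (fun x => -(c * x ^ 2) + d) (-(c * (2 * s))) s := by
      simpa using ((hasDerivAt_pow 2 s).const_mul c).neg.add_const d
    simp only [funext h]
    convert hd.exp using 1
    rw [Real.coe_toNNReal _ (by positivity)]
    field_simp
    rw [h]
    ring_nf

end
end

section
/- Let μ be a probability measure on ℝ with density e^{−V}, where e^{−V} ∈ C²(ℝ) is everywhere positive, and with ∫_ℝ |t|⁵ dμ(t) < ∞. Let Φ(s) = μ((−∞, s]) and, for a, b > 0, define H_{a,b}(x,y) = Φ(a Φ^{−1}(x) + b Φ^{−1}(y)) on [0,1]² \ {(0,1),(1,0)} with H_{a,b}(0,1) = H_{a,b}(1,0) = 0. Assume that for all a, b > 0 with a + b ≥ 1 and |a − b| ≤ 1, the function H_{a,b} satisfies inequality (★) for μ with n = 1 (for all Borel measurable (f,g) : ℝ × ℝ → [0,1]²). Then: (i) ∫_ℝ x e^{−V(x)} dx = 0; (ii) V' is a convex function; and (iii) there exist constants c₊ ≥ c₋ > 0 such that lim_{x→+∞} |V'(x) − c₊ x| = 0 and lim_{x→−∞}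 |V'(x) − c₋ x| = 0. -/
open MeasureTheory Real Filter

noncomputable section

open scoped Topology

/-- The integral over `Iic s` of a continuous integrable function is a primitive of it. -/
theorem hasDerivAt_integral_Iic {φ : ℝ → ℝ} (hφ : Continuous φ) (hint : Integrable φ) (s : ℝ) :
    HasDerivAt (fun s => ∫ x in Set.Iic s, φ x) (φ s) s := by
  have key : (fun s => ∫ x in Set.Iic s, φ x)
      = fun s => (∫ x in Set.Iic 0, φ x) + ∫ x in (0 : ℝ)..s, φ x := by
    funext s
    rw [← intervalIntegral.integral_Iic_sub_Iic hint.integrableOn hint.integrableOn]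
    ring
  rw [key]
  exact (intervalIntegral.integral_hasDerivAt_right (hφ.intervalIntegrable _ _)
    (hφ.stronglyMeasurableAtFilter _ _) hφ.continuousAt).const_add _

/-- Second order Taylor expansion with Peano remainder. -/
theorem tendsto_taylor_second {Φ φ : ℝ → ℝ} {p φ' : ℝ} (hΦ : ∀ s, HasDerivAt Φ (φ s) s)
    (hφ : HasDerivAt φ φ' p) :
    Tendsto (fun h => (Φ (p + h) - Φ p - φ p * h) / h ^ 2) (𝓝[≠] 0) (𝓝 (φ' / 2)) := by
  have hd : ∀ h : ℝ, HasDerivAt (fun h => Φ (p + h) - Φ p - φ p * h) (φ (p + h) - φ p) h := by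
    intro h
    have h1 : HasDerivAt (fun h => Φ (p + h)) (φ (p + h)) h := (hΦ (p + h)).comp_const_add p h
    simpa using (h1.sub_const (Φ p)).fun_sub ((hasDerivAt_id h).const_mul (φ p))
  refine HasDerivAt.lhopital_zero_nhdsNE (f' := fun h => φ (p + h) - φ p)
    (g' := fun h => 2 * h) (Eventually.of_forall hd)
    (Eventually.of_forall fun h => by simpa using hasDerivAt_pow 2 h) ?_ ?_ ?_ ?_
  · filter_upwards [self_mem_nhdsWithin] with h hh
    exact mul_ne_zero two_ne_zero hh
  · have := (hd 0).continuousAt.tendsto.mono_left (nhdsWithin_le_nhds (s := {0}ᶜ))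
    simpa using this
  · have : Tendsto (fun h : ℝ => h ^ 2) (𝓝 0) (𝓝 0) := by
      simpa using (continuous_pow 2).tendsto (0 : ℝ)
    exact this.mono_left nhdsWithin_le_nhds
  · have := (hasDerivAt_iff_tendsto_slope_zero.1 hφ).div_const 2
    refine this.congr' ?_
    filter_upwards [self_mem_nhdsWithin] with h hh
    simp only [smul_eq_mul]
    field_simp

/-- For a bounded function the second order Taylor remainder is globally quadratic. -/
theorem exists_taylor_bound {Φ φ : ℝ → ℝ} {p φ' : ℝ} (hΦ : ∀ s, HasDerivAt Φ (φ s) s)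
    (hφ : HasDerivAt φ φ' p) (hbd : ∀ s, |Φ s| ≤ 1) :
    ∃ C, ∀ h, |Φ (p + h) - Φ p - φ p * h| ≤ C * h ^ 2 := by
  have hev := (tendsto_taylor_second hΦ hφ).abs.eventually_lt_const
    (show |φ' / 2| < |φ' / 2| + 1 by linarith)
  rw [eventually_nhdsWithin_iff, Metric.eventually_nhds_iff] at hev
  obtain ⟨ε, hε, hev⟩ := hev
  have hC2 : 0 ≤ 2 / ε ^ 2 + |φ p| / ε := by positivity
  refine ⟨|φ' / 2| + 1 + (2 / ε ^ 2 + |φ p| / ε), fun h => ?_⟩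
  rcases eq_or_ne h 0 with rfl | hh
  · simp
  have h2 : 0 < h ^ 2 := by positivity
  rcases lt_or_ge |h| ε with hlt | hge
  · have h3 := hev (y := h) (by simpa using hlt) hh
    rw [abs_div, abs_of_pos h2, div_lt_iff₀ h2] at h3
    nlinarith
  · have h4 : |Φ (p + h) - Φ p - φ p * h| ≤ 2 + |φ p| * |h| := by
      calc _ ≤ |Φ (p + h)| + |Φ p| + |φ p * h| :=
            (abs_sub _ _).trans (by gcongr; exact abs_sub _ _)
        _ ≤ _ := by rw [abs_mul]; linarith [hbd (p + h), hbd p]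
    have h5 : 2 ≤ 2 / ε ^ 2 * h ^ 2 := by
      rw [div_mul_eq_mul_div, le_div_iff₀ (by positivity), ← sq_abs h]
      gcongr
    have h6 : |φ p| * |h| ≤ |φ p| / ε * h ^ 2 := by
      rw [div_mul_eq_mul_div, le_div_iff₀ hε, ← sq_abs h, mul_assoc, pow_two]
      gcongr
    nlinarith [mul_nonneg (show 0 ≤ |φ' / 2| + 1 by positivity) h2.le]

/-- Second order expansion at `δ = 0` of `δ ↦ ∫ Φ (p + δ x) dμ`. -/
theorem tendsto_integral_comp_add_mul {Φ φ : ℝ → ℝ} {p φ' : ℝ} {μ : Measure ℝ}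
    [IsProbabilityMeasure μ] (hΦ : ∀ s, HasDerivAt Φ (φ s) s)
    (hφ : HasDerivAt φ φ' p) (hbd : ∀ s, |Φ s| ≤ 1)
    (hm1 : Integrable (fun x => x) μ) (hm2 : Integrable (fun x => x ^ 2) μ) :
    Tendsto (fun δ => ((∫ x, Φ (p + δ * x) ∂μ) - Φ p - φ p * δ * ∫ x, x ∂μ) / δ ^ 2)
      (𝓝[≠] 0) (𝓝 (φ' / 2 * ∫ x, x ^ 2 ∂μ)) := by
  have hc : Continuous Φ := continuous_iff_continuousAt.2 fun s => (hΦ s).continuousAt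
  obtain ⟨C, hC⟩ := exists_taylor_bound hΦ hφ hbd
  have hi : ∀ δ : ℝ, Integrable (fun x => Φ (p + δ * x)) μ := fun δ =>
    Integrable.of_bound (by fun_prop) 1 (Eventually.of_forall fun x => hbd _)
  have heq : ∀ δ : ℝ, ((∫ x, Φ (p + δ * x) ∂μ) - Φ p - φ p * δ * ∫ x, x ∂μ) / δ ^ 2
      = ∫ x, (Φ (p + δ * x) - Φ p - φ p * (δ * x)) / δ ^ 2 ∂μ := by
    intro δ
    have : (fun x => φ p * (δ * x)) = fun x => φ p * δ * x := by funext x; ring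
    rw [integral_div, integral_sub (f := fun x => Φ (p + δ * x) - Φ p)
      ((hi δ).sub (integrable_const _)) (this ▸ hm1.const_mul _),
      integral_sub (hi δ) (integrable_const _), this, integral_const_mul]
    simp
  simp_rw [heq, ← integral_const_mul]
  refine tendsto_integral_filter_of_dominated_convergence (fun x => C * x ^ 2) ?_ ?_
    (hm2.const_mul _) ?_
  · exact Eventually.of_forall fun δ => by fun_prop
  · filter_upwards [self_mem_nhdsWithin] with δ hδ
    refine Eventually.of_forall fun x => ?_
    have h2 : 0 < δ ^ 2 := by have : δ ≠ 0 := hδ; positivity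
    rw [norm_eq_abs, abs_div, abs_of_pos h2, div_le_iff₀ h2]
    exact (hC _).trans_eq (by ring)
  · refine Eventually.of_forall fun x => ?_
    rcases eq_or_ne x 0 with rfl | hx
    · simp
    have ht : Tendsto (fun δ : ℝ => δ * x) (𝓝[≠] 0) (𝓝[≠] 0) := by
      refine tendsto_nhdsWithin_iff.2 ⟨?_, ?_⟩
      · have : Tendsto (fun δ : ℝ => δ * x) (𝓝 0) (𝓝 (0 * x)) :=
          (continuous_mul_const x).tendsto 0
        rw [zero_mul] at this
        exact this.mono_left nhdsWithin_le_nhds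
      · filter_upwards [self_mem_nhdsWithin] with δ hδ
        exact mul_ne_zero hδ hx
    refine (((tendsto_taylor_second hΦ hφ).comp ht).mul_const (x ^ 2)).congr' ?_
    filter_upwards [self_mem_nhdsWithin] with δ hδ
    have : δ ≠ 0 := hδ
    simp only [Function.comp]
    field_simp

/-- The inverse of a strictly increasing distribution function is differentiable. -/
theorem hasDerivAt_inverse_cdf {Φ φ Φi : ℝ → ℝ} (hΦ : ∀ s, HasDerivAt Φ (φ s) s)
    (hφ : ∀ s, 0 < φ s) (hmono : StrictMono Φ) (hmem : ∀ s, Φ s ∈ Set.Ioo (0 : ℝ) 1)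
    (hΦi : ∀ x ∈ Set.Ioo (0 : ℝ) 1, Φ (Φi x) = x) (p : ℝ) :
    HasDerivAt Φi (φ p)⁻¹ (Φ p) := by
  have hleft : ∀ s, Φi (Φ s) = s := fun s => hmono.injective (hΦi _ (hmem s))
  have hnhds : Set.Ioo (0 : ℝ) 1 ∈ 𝓝 (Φ p) := isOpen_Ioo.mem_nhds (hmem p)
  have hmono' : StrictMonoOn Φi (Set.Ioo 0 1) := fun x hx y hy hxy => by
    rwa [← hmono.lt_iff_lt, hΦi x hx, hΦi y hy]
  have himage : Φi '' Set.Ioo 0 1 = Set.univ :=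
    Set.eq_univ_of_forall fun s => ⟨Φ s, hmem s, hleft s⟩
  have hcont : ContinuousAt Φi (Φ p) :=
    hmono'.continuousAt_of_image_mem_nhds hnhds (by rw [himage]; exact univ_mem)
  refine HasDerivAt.of_local_left_inverse hcont (f := Φ) ?_ (hφ p).ne' ?_
  · rw [hleft]; exact hΦ p
  · filter_upwards [hnhds] with x hx using hΦi x hx

/-- First order expansion of the `Φ`-mean of an affine function. -/
theorem hasDerivAt_cdf_mean {Φ φ Φi : ℝ → ℝ} {p φ' : ℝ} {μ : Measure ℝ}
    [IsProbabilityMeasure μ] (hΦ : ∀ s, HasDerivAt Φ (φ s) s)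
    (hφ : HasDerivAt φ φ' p) (hpos : 0 < φ p) (hbd : ∀ s, |Φ s| ≤ 1)
    (hinv : HasDerivAt Φi (φ p)⁻¹ (Φ p))
    (hm1 : Integrable (fun x => x) μ) (hm2 : Integrable (fun x => x ^ 2) μ) :
    HasDerivAt (fun δ => Φi (∫ x, Φ (p + δ * x) ∂μ)) (∫ x, x ∂μ) 0 := by
  have h0 : ∫ x, Φ (p + 0 * x) ∂μ = Φ p := by simp
  have hM : HasDerivAt (fun δ => ∫ x, Φ (p + δ * x) ∂μ) (φ p * ∫ x, x ∂μ) 0 := by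
    rw [hasDerivAt_iff_tendsto_slope_zero]
    have hid : Tendsto (fun δ : ℝ => δ) (𝓝[≠] 0) (𝓝 0) := nhdsWithin_le_nhds
    have := (hid.mul (tendsto_integral_comp_add_mul hΦ hφ hbd hm1 hm2)).add_const
      (φ p * ∫ x, x ∂μ)
    rw [zero_mul, zero_add] at this
    refine this.congr' ?_
    filter_upwards [self_mem_nhdsWithin] with δ hδ
    have : δ ≠ 0 := hδ
    rw [h0, zero_add, smul_eq_mul]
    field_simp
    ring
  rw [← h0] at hinv
  rw [← inv_mul_cancel_left₀ hpos.ne' (∫ x, x ∂μ)]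
  exact hinv.comp (0 : ℝ) hM

/-- Second order expansion of the `Φ`-mean of an affine function, for centered `μ`. -/
theorem hasDerivWithinAt_cdf_mean_sqrt {Φ φ Φi : ℝ → ℝ} {p φ' : ℝ} {μ : Measure ℝ}
    [IsProbabilityMeasure μ] (hΦ : ∀ s, HasDerivAt Φ (φ s) s)
    (hφ : HasDerivAt φ φ' p) (hbd : ∀ s, |Φ s| ≤ 1)
    (hinv : HasDerivAt Φi (φ p)⁻¹ (Φ p)) (hmean : ∫ x, x ∂μ = 0)
    (hm1 : Integrable (fun x => x) μ) (hm2 : Integrable (fun x => x ^ 2) μ) :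
    HasDerivWithinAt (fun t => Φi (∫ x, Φ (p + √t * x) ∂μ))
      (φ' / φ p * ((∫ x, x ^ 2 ∂μ) / 2)) (Set.Ioi 0) 0 := by
  have h0 : ∫ x, Φ (p + √0 * x) ∂μ = Φ p := by simp
  have hM : HasDerivWithinAt (fun t => ∫ x, Φ (p + √t * x) ∂μ) (φ' / 2 * ∫ x, x ^ 2 ∂μ)
      (Set.Ioi 0) 0 := by
    rw [hasDerivWithinAt_iff_tendsto_slope' (by simp)]
    have ht : Tendsto (fun t : ℝ => √t) (𝓝[>] 0) (𝓝[≠] 0) := by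
      refine tendsto_nhdsWithin_iff.2 ⟨?_, ?_⟩
      · have := Real.continuous_sqrt.tendsto 0
        rw [Real.sqrt_zero] at this
        exact this.mono_left nhdsWithin_le_nhds
      · filter_upwards [self_mem_nhdsWithin] with t ht
        exact (Real.sqrt_pos.2 ht).ne'
    refine ((tendsto_integral_comp_add_mul hΦ hφ hbd hm1 hm2).comp ht).congr' ?_
    filter_upwards [self_mem_nhdsWithin] with t ht
    rw [slope_def_field, Function.comp, h0, hmean, mul_zero, sub_zero, sub_zero,
      Real.sq_sqrt (le_of_lt ht)]
  rw [← h0] at hinv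
  have hval : φ' / φ p * ((∫ x, x ^ 2 ∂μ) / 2) = (φ p)⁻¹ * (φ' / 2 * ∫ x, x ^ 2 ∂μ) := by ring
  rw [hval]
  exact hinv.comp_hasDerivWithinAt (0 : ℝ) hM

/-- Inequality (★) tested on `f = Φ (p + δ x)` and `g = Φ (q + δ x)`. -/
theorem StarIneq1.cdf_mean_le {a b : ℝ} (ha : 0 < a) (hb : 0 < b) {μ : Measure ℝ}
    [IsProbabilityMeasure μ] {Φ Φi : ℝ → ℝ} {H : ℝ × ℝ → ℝ} (hc : Continuous Φ)
    (hmono : StrictMono Φ) (hmem : ∀ s, Φ s ∈ Set.Ioo (0 : ℝ) 1)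
    (hΦi : ∀ x ∈ Set.Ioo (0 : ℝ) 1, Φ (Φi x) = x)
    (hH : ∀ x ∈ Set.Ioo (0 : ℝ) 1, ∀ y ∈ Set.Ioo (0 : ℝ) 1,
      H (x, y) = Φ (a * Φi x + b * Φi y))
    (hstar : StarIneq1 a b (Set.Icc ((0 : ℝ), (0 : ℝ)) (1, 1)) H μ) (p q δ : ℝ) :
    a * Φi (∫ x, Φ (p + δ * x) ∂μ) + b * Φi (∫ x, Φ (q + δ * x) ∂μ) ≤
      Φi (∫ x, Φ (a * p + b * q + δ * x) ∂μ) := by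
  have hleft : ∀ s, Φi (Φ s) = s := fun s => hmono.injective (hΦi _ (hmem s))
  have hi : ∀ r : ℝ, Integrable (fun x => Φ (r + δ * x)) μ := fun r =>
    Integrable.of_bound (by fun_prop) 1 (Eventually.of_forall fun x => by
      rw [norm_eq_abs, abs_of_pos (hmem _).1]; exact (hmem _).2.le)
  have hM : ∀ r : ℝ, ∫ x, Φ (r + δ * x) ∂μ ∈ Set.Ioo (0 : ℝ) 1 := by
    intro r
    have hpos : ∀ f : ℝ → ℝ, (∀ x, 0 < f x) → Integrable f μ → 0 < ∫ x, f x ∂μ := by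
      intro f hf hfi
      rw [integral_pos_iff_support_of_nonneg (fun x => (hf x).le) hfi]
      have : Function.support f = Set.univ := Set.eq_univ_of_forall fun x => (hf x).ne'
      simp [this]
    refine ⟨hpos _ (fun x => (hmem _).1) (hi r), ?_⟩
    have := hpos (fun x => 1 - Φ (r + δ * x)) (fun x => sub_pos.2 (hmem _).2)
      ((integrable_const _).sub (hi r))
    rw [integral_sub (integrable_const _) (hi r)] at this
    simpa using this
  have key := hstar (fun x => Φ (p + δ * x)) (fun x => Φ (q + δ * x))
    (by fun_prop) (by fun_prop)
    (fun x y => ⟨⟨(hmem _).1.le, (hmem _).1.le⟩, ⟨(hmem _).2.le, (hmem _).2.le⟩⟩)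
  have hsup : ∀ x : ℝ, essSup (fun y => H (Φ (p + δ * ((x - y) / a)), Φ (q + δ * (y / b)))) volume
      = Φ (a * p + b * q + δ * x) := by
    intro x
    have : (fun y => H (Φ (p + δ * ((x - y) / a)), Φ (q + δ * (y / b))))
        = fun _ => Φ (a * p + b * q + δ * x) := by
      funext y
      rw [hH _ (hmem _) _ (hmem _), hleft, hleft]
      congr 1
      field_simp
      ring
    rw [this]
    exact essSup_const' _
  simp_rw [hsup] at key
  rw [hH _ (hM p) _ (hM q)] at key
  rwa [← hmono.le_iff_le, hΦi _ (hM _)]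

/-- A positive integrable density on `ℝ` with zero mean, whose logarithmic derivative is minus a
convex function that is nonnegative at `0`, is Gaussian. -/
theorem gaussian_of_convex_logDeriv {φ W : ℝ → ℝ} (hpos : ∀ x, 0 < φ x)
    (hφ : ∀ x, HasDerivAt φ (-(W x * φ x)) x) (hW : ConvexOn ℝ Set.univ W)
    (hWd : DifferentiableAt ℝ W 0) (hW0 : 0 ≤ W 0)
    (hint : Integrable fun x => x * φ x) (hmean : ∫ x, x * φ x = 0) :
    ∃ c, ∀ x, φ x = φ 0 * Real.exp (-(c * x ^ 2 / 2)) := by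
  set c := deriv W 0
  have htan : ∀ x, c * x ≤ W x := by
    intro x
    rcases lt_trichotomy x 0 with hx | rfl | hx
    · have := hW.slope_le_of_hasDerivAt (Set.mem_univ x) (Set.mem_univ 0) hx hWd.hasDerivAt
      rw [slope_def_field, div_le_iff₀ (by linarith)] at this
      linarith
    · simpa using hW0
    · have := hW.le_slope_of_hasDerivAt (Set.mem_univ 0) (Set.mem_univ x) hx hWd.hasDerivAt
      rw [slope_def_field, le_div_iff₀ (by linarith)] at this
      linarith
  set k : ℝ → ℝ := fun x => φ x * Real.exp (c * x ^ 2 / 2) with hk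
  have hkd : ∀ x, HasDerivAt k ((c * x - W x) * k x) x := by
    intro x
    have h1 : HasDerivAt (fun x : ℝ => c * x ^ 2 / 2) (c * x) x :=
      (((hasDerivAt_pow 2 x).const_mul c).div_const 2).congr_deriv (by simp; ring)
    exact ((hφ x).fun_mul h1.exp).congr_deriv (by simp only [hk]; ring)
  have hkpos : ∀ x, 0 < k x := fun x => mul_pos (hpos x) (Real.exp_pos _)
  have hanti : Antitone k := antitone_of_hasDerivAt_nonpos hkd fun x =>
    mul_nonpos_of_nonpos_of_nonneg (sub_nonpos.2 (htan x)) (hkpos x).le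
  have hcont : Continuous φ := continuous_iff_continuousAt.2 fun s => (hφ s).continuousAt
  have hφk : ∀ x, φ x = k x * Real.exp (-(c * x ^ 2 / 2)) := fun x => by
    rw [hk, mul_assoc, ← Real.exp_add]; simp
  have hodd : ∀ x, 0 ≤ x * φ (-x) - x * φ x := by
    intro x
    rw [← mul_sub, hφk x, hφk (-x), neg_sq, ← sub_mul]
    rcases le_total 0 x with hx | hx
    · exact mul_nonneg hx (mul_nonneg (sub_nonneg.2 (hanti (by linarith))) (Real.exp_pos _).le)
    · exact mul_nonneg_of_nonpos_of_nonpos hx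
        (mul_nonpos_of_nonpos_of_nonneg (sub_nonpos.2 (hanti (by linarith))) (Real.exp_pos _).le)
  have hint' : Integrable fun x => x * φ (-x) := by
    refine hint.comp_neg.neg.congr (Eventually.of_forall fun x => ?_)
    change -(-x * φ (-x)) = x * φ (-x)
    ring
  have hmean' : ∫ x, x * φ (-x) = 0 := by
    have h := integral_neg_eq_self (fun x => x * φ x) volume
    rw [hmean] at h
    rw [← neg_eq_zero, ← integral_neg, ← h]
    exact integral_congr_ae (Eventually.of_forall fun x => (neg_mul x _).symm)
  have hzero : (fun x => x * φ (-x) - x * φ x) = 0 := by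
    rw [← Continuous.ae_eq_iff_eq volume (by fun_prop) continuous_zero]
    exact (integral_eq_zero_iff_of_nonneg hodd (hint'.sub hint)).1
      (by rw [integral_sub hint' hint, hmean, hmean', sub_zero])
  have heven : ∀ x, k (-x) = k x := by
    intro x
    rcases eq_or_ne x 0 with rfl | hx
    · simp
    have := congrFun hzero x
    simp only [Pi.zero_apply, ← mul_sub, mul_eq_zero, hx, false_or] at this
    simp only [hk, neg_sq, sub_eq_zero.1 this]
  have hconst : ∀ x, k x = k 0 := by
    intro x
    have := heven x
    rcases le_total 0 x with hx | hx
    · linarith [hanti hx, hanti (neg_nonpos.2 hx)]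
    · linarith [hanti hx, hanti (neg_nonneg.2 hx)]
  refine ⟨c, fun x => ?_⟩
  rw [hφk x, hconst x]
  simp [hk]

/-- The second order consequence of the superadditivity of `Φ`-means of affine functions. -/
theorem logDeriv_le_of_cdf_mean_le {a b p q : ℝ} {Φ φ φ' Φi : ℝ → ℝ} {μ : Measure ℝ}
    [IsProbabilityMeasure μ] (hΦ : ∀ s, HasDerivAt Φ (φ s) s)
    (hφ : ∀ s, HasDerivAt φ (φ' s) s) (hbd : ∀ s, |Φ s| ≤ 1)
    (hinv : ∀ s, HasDerivAt Φi (φ s)⁻¹ (Φ s)) (hleft : ∀ s, Φi (Φ s) = s)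
    (hmean : ∫ x, x ∂μ = 0) (hm1 : Integrable (fun x => x) μ)
    (hm2 : Integrable (fun x => x ^ 2) μ) (hm2pos : 0 < ∫ x, x ^ 2 ∂μ)
    (hle : ∀ δ : ℝ, a * Φi (∫ x, Φ (p + δ * x) ∂μ) + b * Φi (∫ x, Φ (q + δ * x) ∂μ) ≤
      Φi (∫ x, Φ (a * p + b * q + δ * x) ∂μ)) :
    a * (φ' p / φ p) + b * (φ' q / φ q) ≤ φ' (a * p + b * q) / φ (a * p + b * q) := by
  have hN := fun r => hasDerivWithinAt_cdf_mean_sqrt hΦ (hφ r) hbd (hinv r) hmean hm1 hm2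
  have hG := (hN (a * p + b * q)).fun_sub (((hN p).const_mul a).fun_add ((hN q).const_mul b))
  rw [hasDerivWithinAt_iff_tendsto_slope' (by simp)] at hG
  have hnonneg := ge_of_tendsto hG (b := 0) <| by
    filter_upwards [self_mem_nhdsWithin] with t ht
    rw [slope_def_field]
    refine div_nonneg ?_ (by simpa using le_of_lt ht)
    simpa [hleft] using hle √t
  have hfac : 0 ≤ (φ' (a * p + b * q) / φ (a * p + b * q)
      - (a * (φ' p / φ p) + b * (φ' q / φ q))) * ((∫ x, x ^ 2 ∂μ) / 2) :=
    hnonneg.trans_eq (by ring)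
  exact sub_nonneg.1 (nonneg_of_mul_nonneg_left hfac (by positivity))

/-- A measure with a density satisfying (★) for `a = b = 1` is centered. -/
theorem mean_eq_zero_of_cdf_mean_le {Φ φ φ' Φi : ℝ → ℝ} {μ : Measure ℝ}
    [IsProbabilityMeasure μ] (hΦ : ∀ s, HasDerivAt Φ (φ s) s)
    (hφ : ∀ s, HasDerivAt φ (φ' s) s) (hpos : ∀ s, 0 < φ s) (hbd : ∀ s, |Φ s| ≤ 1)
    (hinv : ∀ s, HasDerivAt Φi (φ s)⁻¹ (Φ s)) (hleft : ∀ s, Φi (Φ s) = s)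
    (hm1 : Integrable (fun x => x) μ) (hm2 : Integrable (fun x => x ^ 2) μ)
    (hle : ∀ δ : ℝ, Φi (∫ x, Φ (δ * x) ∂μ) + Φi (∫ x, Φ (δ * x) ∂μ) ≤
      Φi (∫ x, Φ (δ * x) ∂μ)) :
    ∫ x, x ∂μ = 0 := by
  have hN := hasDerivAt_cdf_mean hΦ (hφ 0) (hpos 0) hbd (hinv 0) hm1 hm2
  simp only [zero_add] at hN
  refine IsLocalMax.hasDerivAt_eq_zero (Eventually.of_forall fun δ => ?_) hN
  simpa [hleft] using hle δ

/-- structure of measures satisfying the functional Ehrhard inequality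
with their own distribution function for all admissible `a, b`. -/
theorem stmt11 (V : ℝ → ℝ) (hV : ContDiff ℝ 2 fun x => Real.exp (-V x))
    (μ : Measure ℝ)
    (hμ : μ = volume.withDensity fun x => ENNReal.ofReal (Real.exp (-V x)))
    (hprob : IsProbabilityMeasure μ)
    (hmom : Integrable (fun t => |t| ^ 5) μ)
    (Φ : ℝ → ℝ) (hΦ : ∀ s, Φ s = (μ (Set.Iic s)).toReal)
    (Φi : ℝ → ℝ) (hΦi : ∀ x ∈ Set.Ioo (0 : ℝ) 1, Φ (Φi x) = x)
    (Hab : ℝ → ℝ → ℝ × ℝ → ℝ)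
    (hHab : ∀ a b x y : ℝ, Hab a b (x, y) =
      if x = 0 ∨ y = 0 then 0
      else if x = 1 ∨ y = 1 then 1
      else Φ (a * Φi x + b * Φi y))
    (hstar : ∀ a b : ℝ, 0 < a → 0 < b → 1 ≤ a + b → |a - b| ≤ 1 →
      StarIneq1 a b (Set.Icc ((0 : ℝ), (0 : ℝ)) (1, 1)) (Hab a b) μ) :
    (∫ x : ℝ, x * Real.exp (-V x)) = 0 ∧
    ConvexOn ℝ Set.univ (deriv V) ∧
    (∃ cp cm : ℝ, 0 < cm ∧ cm ≤ cp ∧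
      Tendsto (fun x => deriv V x - cp * x) atTop (nhds 0) ∧
      Tendsto (fun x => deriv V x - cm * x) atBot (nhds 0)) := by
  set φ : ℝ → ℝ := fun x => Real.exp (-V x) with hφdef
  have hpos : ∀ x, 0 < φ x := fun x => Real.exp_pos _
  have hcont : Continuous φ := hV.continuous
  have hφ : ∀ x, HasDerivAt φ (deriv φ x) x := fun x =>
    (hV.differentiable two_ne_zero x).hasDerivAt
  have hVd : ∀ x, HasDerivAt V (-(deriv φ x / φ x)) x := by
    have hlog : V = fun x => -Real.log (φ x) := by
      funext x; simp [hφdef]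
    intro x
    rw [hlog]
    exact ((hφ x).log (hpos x).ne').fun_neg
  have hW : ∀ x, deriv V x = -(deriv φ x / φ x) := fun x => (hVd x).deriv
  have hdd : Differentiable ℝ (deriv φ) :=
    ((contDiff_succ_iff_deriv (n := 1)).1 hV).2.2.differentiable one_ne_zero
  have hWd : DifferentiableAt ℝ (deriv V) 0 := by
    rw [funext hW]
    exact ((hdd 0).div (hφ 0).differentiableAt (hpos 0).ne').neg
  -- translation between `μ` and Lebesgue measure
  have hint : Integrable φ := by
    have h1 : ∫⁻ x, ENNReal.ofReal (φ x) = 1 := by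
      have := hprob.measure_univ
      rwa [hμ, withDensity_apply _ MeasurableSet.univ, Measure.restrict_univ] at this
    refine ⟨hcont.aestronglyMeasurable, ?_⟩
    rw [hasFiniteIntegral_iff_ofReal (Eventually.of_forall fun x => (hpos x).le), h1]
    exact ENNReal.one_lt_top
  have hΦeq : Φ = fun s => ∫ x in Set.Iic s, φ x := by
    funext s
    rw [hΦ, hμ, withDensity_apply _ measurableSet_Iic,
      integral_eq_lintegral_of_nonneg_ae (Eventually.of_forall fun x => (hpos x).le)
        hcont.aestronglyMeasurable]
  have hmeas : Measurable fun x => ENNReal.ofReal (φ x) := hcont.measurable.ennreal_ofReal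
  have hm1 : Integrable (fun x => x) μ := by
    refine ((integrable_const (1 : ℝ)).add hmom).mono' (by fun_prop)
      (Eventually.of_forall fun x => ?_)
    simp only [Pi.add_apply, norm_eq_abs]
    rcases le_total |x| 1 with h | h
    · linarith [pow_nonneg (abs_nonneg x) 5]
    · linarith [le_self_pow₀ h (show 5 ≠ 0 by norm_num)]
  have hm2 : Integrable (fun x => x ^ 2) μ := by
    refine ((integrable_const (1 : ℝ)).add hmom).mono' (by fun_prop)
      (Eventually.of_forall fun x => ?_)
    simp only [Pi.add_apply, norm_pow, norm_eq_abs]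
    rcases le_total |x| 1 with h | h
    · linarith [pow_nonneg (abs_nonneg x) 5, pow_le_one₀ (n := 2) (abs_nonneg x) h]
    · linarith [pow_le_pow_right₀ h (show 2 ≤ 5 by norm_num)]
  have hm2pos : 0 < ∫ x, x ^ 2 ∂μ := by
    rw [integral_pos_iff_support_of_nonneg (fun x => sq_nonneg x) hm2]
    have hs : Function.support (fun x : ℝ => x ^ 2) = {0}ᶜ := by ext x; simp
    have h0 : μ {0} = 0 := by
      rw [hμ]; exact withDensity_absolutelyContinuous _ _ (by simp)
    rw [hs, (prob_compl_eq_one_iff (measurableSet_singleton 0)).2 h0]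
    exact one_pos
  have hmean_eq : ∫ x, x ∂μ = ∫ x, x * φ x := by
    rw [hμ, integral_withDensity_eq_integral_toReal_smul hmeas (by simp)]
    refine integral_congr_ae (Eventually.of_forall fun x => ?_)
    simp [ENNReal.toReal_ofReal (hpos x).le, mul_comm]
  have hxφ : Integrable fun x => x * φ x := by
    rw [hμ, integrable_withDensity_iff hmeas (by simp)] at hm1
    refine hm1.congr (Eventually.of_forall fun x => ?_)
    simp [ENNReal.toReal_ofReal (hpos x).le]
  -- the distribution function and its inverse
  have hΦd : ∀ s, HasDerivAt Φ (φ s) s := fun s => by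
    rw [hΦeq]; exact hasDerivAt_integral_Iic hcont hint s
  have hΦc : Continuous Φ := continuous_iff_continuousAt.2 fun s => (hΦd s).continuousAt
  have hmono : StrictMono Φ := strictMono_of_hasDerivAt_pos hΦd hpos
  have hmem : ∀ s, Φ s ∈ Set.Ioo (0 : ℝ) 1 := by
    refine fun s => ⟨lt_of_le_of_lt ?_ (hmono (sub_one_lt s)), (hmono (lt_add_one s)).trans_le ?_⟩
    · rw [hΦ]; exact ENNReal.toReal_nonneg
    · rw [hΦ]; exact measureReal_le_one
  have hbd : ∀ s, |Φ s| ≤ 1 := fun s => by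
    rw [abs_of_pos (hmem s).1]; exact (hmem s).2.le
  have hleft : ∀ s, Φi (Φ s) = s := fun s => hmono.injective (hΦi _ (hmem s))
  have hinv := hasDerivAt_inverse_cdf hΦd hpos hmono hmem hΦi
  have hle : ∀ a b : ℝ, 0 < a → 0 < b → 1 ≤ a + b → |a - b| ≤ 1 → ∀ p q δ : ℝ,
      a * Φi (∫ x, Φ (p + δ * x) ∂μ) + b * Φi (∫ x, Φ (q + δ * x) ∂μ) ≤
        Φi (∫ x, Φ (a * p + b * q + δ * x) ∂μ) := by
    intro a b ha hb h1 h2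
    refine (hstar a b ha hb h1 h2).cdf_mean_le ha hb hΦc hmono hmem hΦi ?_
    intro x hx y hy
    rw [hHab, if_neg, if_neg]
    · exact not_or.2 ⟨hx.2.ne, hy.2.ne⟩
    · exact not_or.2 ⟨hx.1.ne', hy.1.ne'⟩
  have hmean : ∫ x, x ∂μ = 0 :=
    mean_eq_zero_of_cdf_mean_le hΦd hφ hpos hbd hinv hleft hm1 hm2 fun δ => by
      simpa using hle 1 1 one_pos one_pos (by norm_num) (by norm_num) 0 0 δ
  have hmean0 : ∫ x, x * φ x = 0 := hmean_eq.symm.trans hmean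
  have hWle : ∀ a b : ℝ, 0 < a → 0 < b → 1 ≤ a + b → |a - b| ≤ 1 → ∀ p q : ℝ,
      deriv V (a * p + b * q) ≤ a * deriv V p + b * deriv V q := by
    intro a b ha hb h1 h2 p q
    have := logDeriv_le_of_cdf_mean_le hΦd hφ hbd hinv hleft hmean hm1 hm2 hm2pos
      (hle a b ha hb h1 h2 p q)
    rw [hW, hW, hW]
    linarith
  have hconv : ConvexOn ℝ Set.univ (deriv V) := by
    refine convexOn_iff_forall_pos.2 ⟨convex_univ, fun p _ q _ a b ha hb hab => ?_⟩
    exact hWle a b ha hb hab.ge (abs_le.2 ⟨by linarith, by linarith⟩) p q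
  refine ⟨hmean0, hconv, ?_⟩
  have hW0 : 0 ≤ deriv V 0 := by
    have := hWle 1 1 one_pos one_pos (by norm_num) (by norm_num) 0 0
    simp only [mul_zero, add_zero, one_mul] at this
    linarith
  obtain ⟨c, hc⟩ := gaussian_of_convex_logDeriv hpos
    (fun x => (hφ x).congr_deriv (by rw [hW]; field_simp [(hpos x).ne'])) hconv hWd hW0 hxφ hmean0
  have hcpos : 0 < c := by
    have h1 : Integrable fun x : ℝ => Real.exp (-(c / 2) * x ^ 2) := by
      refine (hint.const_mul (φ 0)⁻¹).congr (Eventually.of_forall fun x => ?_)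
      simp only
      rw [hc x, inv_mul_cancel_left₀ (hpos 0).ne']
      congr 1
      ring
    linarith [integrable_exp_neg_mul_sq_iff.1 h1]
  have hVeq : V = fun x => V 0 + c * x ^ 2 / 2 := by
    funext x
    have := hc x
    rw [hφdef] at this
    simp only [← Real.exp_add, Real.exp_eq_exp] at this
    linarith
  have hlin : ∀ x, deriv V x - c * x = 0 := by
    intro x
    have h1 : HasDerivAt V (c * (2 * x) / 2) x := by
      rw [hVeq]
      simpa using (((hasDerivAt_pow 2 x).const_mul c).div_const 2).const_add (V 0)
    rw [h1.deriv]
    ring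
  refine ⟨c, c, hcpos, le_rfl, ?_, ?_⟩ <;>
  · simp only [hlin]
    exact tendsto_const_nhds

end
end

section
/- Let a, b > 0 with a + b ≥ 1 and |a − b| ≤ 1, and let H ∈ C³(int(ℝ₊²)) be a 1-homogeneous function (H(λx, λy) = λH(x,y) for all λ ≥ 0) such that H_x and H_y never vanish on int(ℝ₊²). Then the inequality a² H_xx/H_x² + (1−a²−b²) H_xy/(H_x H_y) + b² H_yy/H_y² ≥ 0 holds throughout int(ℝ₊²) if and only if one of the following holds: (i) H is convex; (ii) a + b = 1 and H(x,y) = C x^a y^b for some constant C > 0; (iii) a − b = 1 and H(x,y) = C x^a y^{−b} for some constant C < 0; (iv) b − a = 1 and H(x,y) = C x^{−a} y^b for some constant C < 0. -/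
open MeasureTheory Real Filter

noncomputable section

def Hx (H : ℝ × ℝ → ℝ) (z : ℝ × ℝ) : ℝ := fderiv ℝ H z (1, 0)
def Hy (H : ℝ × ℝ → ℝ) (z : ℝ × ℝ) : ℝ := fderiv ℝ H z (0, 1)
def Hxx (H : ℝ × ℝ → ℝ) (z : ℝ × ℝ) : ℝ := fderiv ℝ (Hx H) z (1, 0)
def Hxy (H : ℝ × ℝ → ℝ) (z : ℝ × ℝ) : ℝ := fderiv ℝ (Hx H) z (0, 1)
def Hyy (H : ℝ × ℝ → ℝ) (z : ℝ × ℝ) : ℝ := fderiv ℝ (Hy H) z (0, 1)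

/-- The open positive quadrant `int(ℝ₊²)`. -/
def posQuad : Set (ℝ × ℝ) := {p : ℝ × ℝ | 0 < p.1 ∧ 0 < p.2}

lemma isOpen_posQuad : IsOpen posQuad :=
  (isOpen_lt continuous_const continuous_fst).inter (isOpen_lt continuous_const continuous_snd)

/-- The profile `t ↦ H (t, 1)` determines a 1-homogeneous function. -/
lemma eq_mul_profile {H : ℝ × ℝ → ℝ}
    (hhom : ∀ l : ℝ, 0 ≤ l → ∀ p ∈ posQuad, H (l • p) = l * H p) {z : ℝ × ℝ}
    (hz : z ∈ posQuad) : H z = z.2 * H (z.1 / z.2, 1) := by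
  obtain ⟨h1, h2⟩ := hz
  rw [← hhom z.2 h2.le (z.1 / z.2, 1) ⟨div_pos h1 h2, one_pos⟩]
  congr 1
  ext
  · simp [mul_div_cancel₀ _ h2.ne']
  · simp

lemma hasFDerivAt_fst_div_snd {z : ℝ × ℝ} (hz : z.2 ≠ 0) :
    HasFDerivAt (fun w : ℝ × ℝ => w.1 / w.2)
      ((1 / z.2) • ContinuousLinearMap.fst ℝ ℝ ℝ
        - (z.1 / z.2 ^ 2) • ContinuousLinearMap.snd ℝ ℝ ℝ) z := by
  have h := HasFDerivAt.mul (hasFDerivAt_fst (𝕜 := ℝ) (p := z))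
    ((hasDerivAt_inv hz).comp_hasFDerivAt z (hasFDerivAt_snd (𝕜 := ℝ) (p := z)))
  refine h.congr_fderiv ?_
  ext
  · simp
  · simp
    field_simp

/-- Derivatives of a 1-homogeneous function through its profile `h`, with `h' = g`, `g' = k`. -/
lemma partials_eq {H : ℝ × ℝ → ℝ} {h g k : ℝ → ℝ}
    (hH : ∀ z ∈ posQuad, H z = z.2 * h (z.1 / z.2))
    (hg : ∀ t, 0 < t → HasDerivAt h (g t) t) (hk : ∀ t, 0 < t → HasDerivAt g (k t) t)
    {z : ℝ × ℝ} (hz : z ∈ posQuad) :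
    Hx H z = g (z.1 / z.2) ∧ Hy H z = h (z.1 / z.2) - z.1 / z.2 * g (z.1 / z.2) ∧
    Hxx H z = k (z.1 / z.2) / z.2 ∧ Hxy H z = -(z.1 / z.2) * k (z.1 / z.2) / z.2 ∧
    Hyy H z = (z.1 / z.2) ^ 2 * k (z.1 / z.2) / z.2 := by
  have first : ∀ w ∈ posQuad, Hx H w = g (w.1 / w.2) ∧
      Hy H w = h (w.1 / w.2) - w.1 / w.2 * g (w.1 / w.2) := by
    intro w hw
    have hw2 : w.2 ≠ 0 := hw.2.ne'
    have hev : H =ᶠ[nhds w] fun w => w.2 * h (w.1 / w.2) :=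
      Filter.eventually_of_mem (isOpen_posQuad.mem_nhds hw) hH
    have hd := (hasFDerivAt_snd (𝕜 := ℝ) (p := w)).mul
      ((hg _ (div_pos hw.1 hw.2)).comp_hasFDerivAt w (hasFDerivAt_fst_div_snd hw2))
    unfold Hx Hy
    rw [HasFDerivAt.fderiv (hd.congr_of_eventuallyEq hev)]
    constructor
    · simp
      field_simp
    · simp
      field_simp
      ring
  have hz2 : z.2 ≠ 0 := hz.2.ne'
  have hevx : Hx H =ᶠ[nhds z] fun w => g (w.1 / w.2) :=
    Filter.eventually_of_mem (isOpen_posQuad.mem_nhds hz) fun w hw => (first w hw).1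
  have hevy : Hy H =ᶠ[nhds z] fun w => h (w.1 / w.2) - w.1 / w.2 * g (w.1 / w.2) :=
    Filter.eventually_of_mem (isOpen_posQuad.mem_nhds hz) fun w hw => (first w hw).2
  have hq := hasFDerivAt_fst_div_snd hz2
  have hpos := div_pos hz.1 hz.2
  have hdg := (hk _ hpos).comp_hasFDerivAt z hq
  have hdy := ((hg _ hpos).comp_hasFDerivAt z hq).sub (hq.mul hdg)
  refine ⟨(first z hz).1, (first z hz).2, ?_, ?_, ?_⟩
  · unfold Hxx
    rw [HasFDerivAt.fderiv (hdg.congr_of_eventuallyEq hevx)]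
    simp
    field_simp
  · unfold Hxy
    rw [HasFDerivAt.fderiv (hdg.congr_of_eventuallyEq hevx)]
    simp
    field_simp
  · unfold Hyy
    rw [HasFDerivAt.fderiv (hdy.congr_of_eventuallyEq hevy)]
    simp
    field_simp

/-- The perspective of a convex function on `(0, ∞)` is convex. -/
lemma convexOn_posQuad_of_profile {H : ℝ × ℝ → ℝ} {h : ℝ → ℝ}
    (hH : ∀ z ∈ posQuad, H z = z.2 * h (z.1 / z.2)) (hc : ConvexOn ℝ (Set.Ioi 0) h) :
    ConvexOn ℝ posQuad H := by
  have hconv : Convex ℝ posQuad := by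
    have : posQuad = Set.Ioi (0 : ℝ) ×ˢ Set.Ioi (0 : ℝ) := by ext; simp [posQuad]
    rw [this]
    exact (convex_Ioi 0).prod (convex_Ioi 0)
  refine ⟨hconv, fun z hz w hw s r hs hr hsr => ?_⟩
  have hv := hconv hz hw hs hr hsr
  rw [hH _ hv, hH z hz, hH w hw]
  have hY : 0 < s * z.2 + r * w.2 := by simpa using hv.2
  have hz2 := hz.2
  have hw2 := hw.2
  have key := hc.2 (div_pos hz.1 hz.2 : z.1 / z.2 ∈ Set.Ioi (0 : ℝ))
    (div_pos hw.1 hw.2 : w.1 / w.2 ∈ Set.Ioi (0 : ℝ))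
    (div_nonneg (mul_nonneg hs hz2.le) hY.le) (div_nonneg (mul_nonneg hr hw2.le) hY.le)
    (by field_simp)
  have harg : (s * z.2 / (s * z.2 + r * w.2)) • (z.1 / z.2)
      + (r * w.2 / (s * z.2 + r * w.2)) • (w.1 / w.2)
      = (s * z.1 + r * w.1) / (s * z.2 + r * w.2) := by
    simp only [smul_eq_mul]
    field_simp
  rw [harg] at key
  have := mul_le_mul_of_nonneg_left key hY.le
  simp only [smul_eq_mul, Prod.fst_add, Prod.snd_add, Prod.smul_fst, Prod.smul_snd] at this ⊢
  refine this.trans (le_of_eq ?_)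
  field_simp

lemma convexOn_profile {H : ℝ × ℝ → ℝ} (hc : ConvexOn ℝ posQuad H) :
    ConvexOn ℝ (Set.Ioi 0) fun t => H (t, 1) := by
  refine ⟨convex_Ioi 0, fun x hx y hy s r hs hr hsr => ?_⟩
  have := hc.2 (show (x, (1 : ℝ)) ∈ posQuad from ⟨hx, one_pos⟩)
    (show (y, (1 : ℝ)) ∈ posQuad from ⟨hy, one_pos⟩) hs hr hsr
  simpa [hsr] using this

lemma convexOn_Ioi_iff {h g k : ℝ → ℝ}
    (hg : ∀ t, 0 < t → HasDerivAt h (g t) t) (hk : ∀ t, 0 < t → HasDerivAt g (k t) t) :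
    ConvexOn ℝ (Set.Ioi 0) h ↔ ∀ t, 0 < t → 0 ≤ k t := by
  constructor
  · intro hc t ht
    have hmono : MonotoneOn g (Set.Ioi 0) := by
      refine (hc.monotoneOn_deriv fun t ht => (hg t ht).differentiableAt).congr ?_
      intro t ht
      exact (hg t ht).deriv
    have h1 := hmono.derivWithin_nonneg (x := t)
    rwa [derivWithin_of_isOpen isOpen_Ioi ht, (hk t ht).deriv] at h1
  · intro hk0
    refine convexOn_of_hasDerivWithinAt2_nonneg (f' := g) (f'' := k) (convex_Ioi 0)
      (fun t ht => (hg t ht).continuousAt.continuousWithinAt) ?_ ?_ ?_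
    all_goals rw [interior_Ioi]
    · exact fun t ht => (hg t ht).hasDerivWithinAt
    · exact fun t ht => (hk t ht).hasDerivWithinAt
    · exact hk0

/-- Euler's ODE `t h' = c h` forces a power law. -/
lemma eq_const_mul_rpow {h g : ℝ → ℝ} {c : ℝ} (hg : ∀ t, 0 < t → HasDerivAt h (g t) t)
    (hode : ∀ t, 0 < t → t * g t = c * h t) {t : ℝ} (ht : 0 < t) : h t = h 1 * t ^ c := by
  have hd : ∀ s ∈ Set.Ioi (0 : ℝ), HasDerivAt (fun s => h s * s ^ (-c)) 0 s := by
    intro s hs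
    have hs0 : s ≠ 0 := ne_of_gt hs
    refine ((hg s hs).mul (Real.hasDerivAt_rpow_const (p := -c) (Or.inl hs0))).congr_deriv ?_
    rw [Real.rpow_sub_one hs0]
    have := hode s hs
    field_simp
    linear_combination s ^ (-c) * this
  have hconst := isOpen_Ioi.is_const_of_deriv_eq_zero (convex_Ioi (0 : ℝ)).isPreconnected
    (fun s hs => (hd s hs).differentiableAt.differentiableWithinAt)
    (fun s hs => (hd s hs).deriv) ht (show (1 : ℝ) ∈ Set.Ioi (0 : ℝ) from Set.mem_Ioi.2 one_pos)
  simp only [Real.one_rpow, mul_one] at hconst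
  rw [← hconst, mul_assoc, ← Real.rpow_add ht]
  simp

/-- If `t h' = c h` wherever `h'' < 0`, then either `h'' ≥ 0` everywhere, or `h'' < 0` and the ODE
holds everywhere. -/
lemma nonneg_or_forall_ode {h g k : ℝ → ℝ} {c : ℝ}
    (hg : ∀ t, 0 < t → HasDerivAt h (g t) t) (hk : ∀ t, 0 < t → HasDerivAt g (k t) t)
    (hkc : ContinuousOn k (Set.Ioi 0)) (hg0 : ∀ t, 0 < t → g t ≠ 0)
    (hode : ∀ t, 0 < t → k t < 0 → t * g t = c * h t) :
    (∀ t, 0 < t → 0 ≤ k t) ∨ ∀ t, 0 < t → k t < 0 ∧ t * g t = c * h t := by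
  by_contra! hcon
  obtain ⟨⟨t₀, ht₀, hkt₀⟩, t₁, ht₁, hkt₁⟩ := hcon
  have hnhds : ∀ t, 0 < t → k t < 0 → ∀ᶠ s in nhds t, 0 < s ∧ k s < 0 := fun t ht hkt =>
    (eventually_gt_nhds ht).and ((hkc.continuousAt (Ioi_mem_nhds ht)).eventually_lt_const hkt)
  have hode2 : ∀ t, 0 < t → k t < 0 → t * k t = (c - 1) * g t := by
    intro t ht hkt
    have hev : (fun s => s * g s) =ᶠ[nhds t] fun s => c * h s :=
      (hnhds t ht hkt).mono fun s hs => hode s hs.1 hs.2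
    have h1 := (hasDerivAt_id t).mul (hk t ht)
    have h2 := ((hg t ht).const_mul c).congr_of_eventuallyEq hev
    have := h1.unique h2
    simp only [id] at this
    linarith
  have hsub : Set.Ioi (0 : ℝ) ⊆ {t | 0 < t ∧ k t < 0} := by
    refine (convex_Ioi (0 : ℝ)).isPreconnected.subset_of_closure_inter_subset
      (isOpen_iff_mem_nhds.2 fun t ht => hnhds t ht.1 ht.2) ⟨t₀, ht₀, ht₀, hkt₀⟩ ?_
    rintro t ⟨htc, ht⟩
    have hne : (nhdsWithin t {t | 0 < t ∧ k t < 0}).NeBot := mem_closure_iff_nhdsWithin_neBot.1 htc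
    have hkt := (hkc.continuousAt (Ioi_mem_nhds ht)).tendsto.mono_left
      (nhdsWithin_le_nhds (s := {t | 0 < t ∧ k t < 0}))
    have hgt := (hk t ht).continuousAt.tendsto.mono_left
      (nhdsWithin_le_nhds (s := {t | 0 < t ∧ k t < 0}))
    have hid := (continuousAt_id (x := t)).tendsto.mono_left
      (nhdsWithin_le_nhds (s := {t | 0 < t ∧ k t < 0}))
    have hle : k t ≤ 0 := le_of_tendsto hkt
      (eventually_mem_nhdsWithin.mono fun s hs => hs.2.le)
    have heq : t * k t = (c - 1) * g t := tendsto_nhds_unique_of_eventuallyEq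
      (hid.mul hkt) (hgt.const_mul (c - 1))
      (eventually_mem_nhdsWithin.mono fun s hs => hode2 s hs.1 hs.2)
    refine ⟨ht, lt_of_le_of_ne hle fun h0 => ?_⟩
    have hc : c - 1 ≠ 0 := by
      intro hc
      have := hode2 t₀ ht₀ hkt₀
      rw [hc, zero_mul] at this
      exact (mul_neg_of_pos_of_neg ht₀ hkt₀).ne this
    rw [h0, mul_zero] at heq
    exact mul_ne_zero hc (hg0 t ht) heq.symm
  exact hkt₁ (hsub ht₁).2 (hode t₁ ht₁ (hsub ht₁).2)

lemma pdi_form_nonneg {a b : ℝ} (ha : 0 < a) (hb : 0 < b) (hab1 : 1 ≤ a + b)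
    (hab2 : |a - b| ≤ 1) (q X : ℝ) :
    0 ≤ a ^ 2 * q ^ 2 - (1 - a ^ 2 - b ^ 2) * (X * q) + b ^ 2 * X ^ 2 := by
  obtain ⟨h1, h2⟩ := abs_le.1 hab2
  have e1 : 1 - a ^ 2 - b ^ 2 ≤ 2 * a * b := by nlinarith
  have e2 : -(2 * a * b) ≤ 1 - a ^ 2 - b ^ 2 := by nlinarith
  rcases le_total 0 (X * q) with h | h
  · nlinarith [sq_nonneg (a * q - b * X), mul_le_mul_of_nonneg_right e1 h]
  · nlinarith [sq_nonneg (a * q + b * X), mul_le_mul_of_nonpos_right e2 h]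

/-- The equality cases of the quadratic form behind the differential inequality. -/
lemma pdi_form_eq_zero {a b : ℝ} (ha : 0 < a) (hb : 0 < b) (hab1 : 1 ≤ a + b)
    (hab2 : |a - b| ≤ 1) {q X : ℝ} (hq : q ≠ 0) (hX : X ≠ 0)
    (h0 : a ^ 2 * q ^ 2 - (1 - a ^ 2 - b ^ 2) * (X * q) + b ^ 2 * X ^ 2 ≤ 0) :
    (a + b = 1 ∧ X = a * (q + X)) ∨ (a - b = 1 ∧ X = a * (q + X)) ∨
      (b - a = 1 ∧ X = -a * (q + X)) := by
  obtain ⟨h1, h2⟩ := abs_le.1 hab2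
  have e1 : 1 - a ^ 2 - b ^ 2 ≤ 2 * a * b := by nlinarith
  have e2 : -(2 * a * b) ≤ 1 - a ^ 2 - b ^ 2 := by nlinarith
  rcases lt_or_gt_of_ne (mul_ne_zero hX hq) with h | h
  · have hz : a * q + b * X = 0 := by
      nlinarith [sq_nonneg (a * q + b * X), mul_le_mul_of_nonpos_right e2 h.le]
    have hp : (1 - (a - b) ^ 2) * (X * q) = 0 := by
      have := mul_le_mul_of_nonpos_right e2 h.le
      nlinarith [sq_nonneg (a * q + b * X)]
    have : (1 - (a - b)) * (1 + (a - b)) = 0 := by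
      have := (mul_eq_zero.1 hp).resolve_right h.ne
      linear_combination this
    rcases mul_eq_zero.1 this with hab | hab
    · right; left
      exact ⟨by linarith, by linear_combination -hz + X * hab⟩
    · right; right
      exact ⟨by linarith, by linear_combination hz + X * hab⟩
  · have hz : a * q - b * X = 0 := by
      nlinarith [sq_nonneg (a * q - b * X), mul_le_mul_of_nonneg_right e1 h.le]
    have hp : ((a + b) ^ 2 - 1) * (X * q) = 0 := by
      have := mul_le_mul_of_nonneg_right e1 h.le
      nlinarith [sq_nonneg (a * q - b * X)]
    have : (a + b - 1) * (a + b + 1) = 0 := by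
      have := (mul_eq_zero.1 hp).resolve_right h.ne'
      linear_combination this
    rcases mul_eq_zero.1 this with hab | hab
    · left
      exact ⟨by linarith, by linear_combination -hz - X * hab⟩
    · linarith

/-- A 1-homogeneous function whose profile satisfies `t h' = c h` and `h'' < 0` is a monomial. -/
lemma eq_power_of_forall_ode {H : ℝ × ℝ → ℝ} {h g k : ℝ → ℝ} {c : ℝ}
    (hH : ∀ z ∈ posQuad, H z = z.2 * h (z.1 / z.2))
    (hg : ∀ t, 0 < t → HasDerivAt h (g t) t) (hk : ∀ t, 0 < t → HasDerivAt g (k t) t)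
    (hode : ∀ t, 0 < t → k t < 0 ∧ t * g t = c * h t) :
    h 1 * (c * (c - 1)) < 0 ∧ ∀ p ∈ posQuad, H p = h 1 * p.1 ^ c * p.2 ^ (1 - c) := by
  constructor
  · have hev : (fun s => s * g s) =ᶠ[nhds 1] fun s => c * h s :=
      (eventually_gt_nhds one_pos).mono fun s hs => (hode s hs).2
    have h1 := (hasDerivAt_id (1 : ℝ)).mul (hk 1 one_pos)
    have h2 := ((hg 1 one_pos).const_mul c).congr_of_eventuallyEq hev
    have h3 := h1.unique h2
    obtain ⟨h4, h5⟩ := hode 1 one_pos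
    simp only [id, one_mul] at h3 h5
    have : h 1 * (c * (c - 1)) = k 1 := by
      linear_combination -h3 - (c - 1) * h5
    rwa [this]
  · intro p hp
    rw [hH p hp, eq_const_mul_rpow hg (fun t ht => (hode t ht).2) (div_pos hp.1 hp.2),
      Real.div_rpow hp.1.le hp.2.le, Real.rpow_sub hp.2, Real.rpow_one]
    ring

/-- characterization of 1-homogeneous functions satisfying the PDI. -/
theorem stmt12 (a b : ℝ) (ha : 0 < a) (hb : 0 < b) (hab1 : 1 ≤ a + b) (hab2 : |a - b| ≤ 1)
    (H : ℝ × ℝ → ℝ) (hH : ContDiffOn ℝ 3 H posQuad)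
    (hhom : ∀ l : ℝ, 0 ≤ l → ∀ p ∈ posQuad, H (l • p) = l * H p)
    (hHx : ∀ z ∈ posQuad, Hx H z ≠ 0)
    (hHy : ∀ z ∈ posQuad, Hy H z ≠ 0) :
    (∀ z ∈ posQuad,
      0 ≤ a ^ 2 * Hxx H z / (Hx H z) ^ 2
          + (1 - a ^ 2 - b ^ 2) * Hxy H z / (Hx H z * Hy H z)
          + b ^ 2 * Hyy H z / (Hy H z) ^ 2) ↔
    (ConvexOn ℝ posQuad H ∨
      (a + b = 1 ∧ ∃ C : ℝ, 0 < C ∧ ∀ p ∈ posQuad, H p = C * p.1 ^ a * p.2 ^ b) ∨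
      (a - b = 1 ∧ ∃ C : ℝ, C < 0 ∧ ∀ p ∈ posQuad, H p = C * p.1 ^ a * p.2 ^ (-b)) ∨
      (b - a = 1 ∧ ∃ C : ℝ, C < 0 ∧ ∀ p ∈ posQuad, H p = C * p.1 ^ (-a) * p.2 ^ b)) := by
  set h : ℝ → ℝ := fun t => H (t, 1) with h_def
  set g := deriv h with g_def
  set k := deriv g with k_def
  have hcd : ContDiffOn ℝ 3 h (Set.Ioi 0) :=
    hH.comp (contDiff_id.prodMk contDiff_const).contDiffOn fun t ht => ⟨ht, one_pos⟩
  have hcg : ContDiffOn ℝ 2 g (Set.Ioi 0) := hcd.deriv_of_isOpen isOpen_Ioi (by norm_num)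
  have hck : ContDiffOn ℝ 1 k (Set.Ioi 0) := hcg.deriv_of_isOpen isOpen_Ioi (by norm_num)
  have hg : ∀ t, 0 < t → HasDerivAt h (g t) t := fun t ht =>
    ((hcd.differentiableOn (by norm_num)).differentiableAt (Ioi_mem_nhds ht)).hasDerivAt
  have hk : ∀ t, 0 < t → HasDerivAt g (k t) t := fun t ht =>
    ((hcg.differentiableOn (by norm_num)).differentiableAt (Ioi_mem_nhds ht)).hasDerivAt
  have hprof : ∀ z ∈ posQuad, H z = z.2 * h (z.1 / z.2) := fun z hz => eq_mul_profile hhom hz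
  have hmem : ∀ t : ℝ, 0 < t → (t, (1 : ℝ)) ∈ posQuad := fun t ht => ⟨ht, one_pos⟩
  have hg0 : ∀ t, 0 < t → g t ≠ 0 := fun t ht => by
    have := hHx _ (hmem t ht)
    rwa [(partials_eq hprof hg hk (hmem t ht)).1, div_one] at this
  have hq0 : ∀ t, 0 < t → h t - t * g t ≠ 0 := fun t ht => by
    have := hHy _ (hmem t ht)
    rwa [(partials_eq hprof hg hk (hmem t ht)).2.1, div_one] at this
  have hpdi : (∀ z ∈ posQuad,
      0 ≤ a ^ 2 * Hxx H z / (Hx H z) ^ 2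
          + (1 - a ^ 2 - b ^ 2) * Hxy H z / (Hx H z * Hy H z)
          + b ^ 2 * Hyy H z / (Hy H z) ^ 2) ↔
      ∀ t, 0 < t → 0 ≤ k t * (a ^ 2 * (h t - t * g t) ^ 2
        - (1 - a ^ 2 - b ^ 2) * (t * g t * (h t - t * g t)) + b ^ 2 * (t * g t) ^ 2) := by
    have hval : ∀ z ∈ posQuad, a ^ 2 * Hxx H z / (Hx H z) ^ 2
          + (1 - a ^ 2 - b ^ 2) * Hxy H z / (Hx H z * Hy H z)
          + b ^ 2 * Hyy H z / (Hy H z) ^ 2 =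
        k (z.1 / z.2) * (a ^ 2 * (h (z.1 / z.2) - z.1 / z.2 * g (z.1 / z.2)) ^ 2
          - (1 - a ^ 2 - b ^ 2) *
            (z.1 / z.2 * g (z.1 / z.2) * (h (z.1 / z.2) - z.1 / z.2 * g (z.1 / z.2)))
          + b ^ 2 * (z.1 / z.2 * g (z.1 / z.2)) ^ 2) /
        (z.2 * g (z.1 / z.2) ^ 2 * (h (z.1 / z.2) - z.1 / z.2 * g (z.1 / z.2)) ^ 2) := by
      intro z hz
      have ht : 0 < z.1 / z.2 := div_pos hz.1 hz.2
      have hz2 := hz.2.ne'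
      obtain ⟨e1, e2, e3, e4, e5⟩ := partials_eq hprof hg hk hz
      rw [e1, e2, e3, e4, e5]
      have hg1 := hg0 _ ht
      have hq1 := hq0 _ ht
      generalize h (z.1 / z.2) - z.1 / z.2 * g (z.1 / z.2) = q at *
      generalize z.1 / z.2 = t at *
      field_simp
      ring
    have hden : ∀ z ∈ posQuad, 0 < z.2 * g (z.1 / z.2) ^ 2 *
        (h (z.1 / z.2) - z.1 / z.2 * g (z.1 / z.2)) ^ 2 := fun z hz => by
      have ht : 0 < z.1 / z.2 := div_pos hz.1 hz.2
      have h1 := hg0 _ ht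
      have h2 := hq0 _ ht
      have h3 := hz.2
      positivity
    constructor
    · intro hall t ht
      have h1 := hall _ (hmem t ht)
      have h2 := hden _ (hmem t ht)
      rw [hval _ (hmem t ht), le_div_iff₀ h2, zero_mul] at h1
      simpa using h1
    · intro hall z hz
      rw [hval z hz]
      exact div_nonneg (hall _ (div_pos hz.1 hz.2)) (hden z hz).le
  have hconv : ConvexOn ℝ posQuad H ↔ ∀ t, 0 < t → 0 ≤ k t :=
    ⟨fun hc => (convexOn_Ioi_iff hg hk).1 (convexOn_profile hc),
      fun hk0 => convexOn_posQuad_of_profile hprof ((convexOn_Ioi_iff hg hk).2 hk0)⟩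
  rw [hpdi, hconv]
  constructor
  · intro hall
    have hzero : ∀ t, 0 < t → k t < 0 →
        (a + b = 1 ∧ t * g t = a * h t) ∨ (a - b = 1 ∧ t * g t = a * h t) ∨
          (b - a = 1 ∧ t * g t = -a * h t) := by
      intro t ht hkt
      have := pdi_form_eq_zero ha hb hab1 hab2 (hq0 t ht) (mul_ne_zero ht.ne' (hg0 t ht))
        (nonpos_of_mul_nonneg_right (hall t ht) hkt)
      simpa using this
    by_cases hba : b - a = 1
    · rcases nonneg_or_forall_ode (c := -a) hg hk hck.continuousOn hg0 (fun t ht hkt => by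
        rcases hzero t ht hkt with ⟨h1, -⟩ | ⟨h1, -⟩ | ⟨-, h1⟩
        · linarith
        · linarith
        · exact h1) with hnn | hode
      · exact Or.inl hnn
      · obtain ⟨hsign, hpow⟩ := eq_power_of_forall_ode hprof hg hk hode
        refine Or.inr (Or.inr (Or.inr ⟨hba, h 1, ?_, ?_⟩))
        · exact neg_of_mul_neg_left hsign (by nlinarith)
        · simpa [show 1 - -a = b by linarith] using hpow
    · rcases nonneg_or_forall_ode (c := a) hg hk hck.continuousOn hg0 (fun t ht hkt => by
        rcases hzero t ht hkt with ⟨-, h1⟩ | ⟨-, h1⟩ | ⟨h1, -⟩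
        · exact h1
        · exact h1
        · exact absurd h1 hba) with hnn | hode
      · exact Or.inl hnn
      · obtain ⟨hsign, hpow⟩ := eq_power_of_forall_ode hprof hg hk hode
        rcases hzero 1 one_pos (hode 1 one_pos).1 with ⟨h1, -⟩ | ⟨h1, -⟩ | ⟨h1, -⟩
        · refine Or.inr (Or.inl ⟨h1, h 1, ?_, ?_⟩)
          · exact pos_of_mul_neg_left hsign (by nlinarith)
          · simpa [show 1 - a = b by linarith] using hpow
        · refine Or.inr (Or.inr (Or.inl ⟨h1, h 1, ?_, ?_⟩))
          · exact neg_of_mul_neg_left hsign (by nlinarith)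
          · simpa [show 1 - a = -b by linarith] using hpow
        · exact absurd h1 hba
  · rintro (hk0 | hpow)
    · exact fun t ht => mul_nonneg (hk0 t ht) (pdi_form_nonneg ha hb hab1 hab2 _ _)
    · intro t ht
      have hode : ∀ C c d : ℝ, (∀ p ∈ posQuad, H p = C * p.1 ^ c * p.2 ^ d) →
          t * g t = c * h t := by
        intro C c d hp
        have hev : h =ᶠ[nhds t] fun s => C * s ^ c :=
          (eventually_gt_nhds ht).mono fun s hs => by simpa using hp _ (hmem s hs)
        have hd := ((Real.hasDerivAt_rpow_const (p := c) (Or.inl ht.ne')).const_mul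
          C).congr_of_eventuallyEq hev
        rw [(hg t ht).unique hd, hev.eq_of_nhds, Real.rpow_sub_one ht.ne']
        field_simp
      refine le_of_eq ?_
      rcases hpow with ⟨hab, C, -, hp⟩ | ⟨hab, C, -, hp⟩ | ⟨hab, C, -, hp⟩
      · obtain rfl : b = 1 - a := by linarith
        rw [hode C _ _ hp]
        ring
      · obtain rfl : b = a - 1 := by linarith
        rw [hode C _ _ hp]
        ring
      · obtain rfl : b = 1 + a := by linarith
        rw [hode C _ _ hp]
        ring

end
end

section
/- Let a, b > 0, let Ω ⊂ ℝ² be a closed bounded rectangle, let μ be a probability measure on ℝⁿ, and let H₁, H₂ ∈ C(Ω). If H₁ satisfies inequality (★) for μ and H₂ satisfies inequality (★) for μ, then H = max(H₁, H₂) also satisfies inequality (★) for μ. -/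
open MeasureTheory Real Filter

noncomputable section

abbrev Euc (n : ℕ) := EuclideanSpace ℝ (Fin n)

/-- Inequality (★). -/
def StarIneq {n : ℕ} (a b : ℝ) (Ω : Set (ℝ × ℝ)) (H : ℝ × ℝ → ℝ)
    (μ : Measure (Euc n)) : Prop :=
  ∀ f g : Euc n → ℝ, Measurable f → Measurable g →
    (∀ x y, (f x, g y) ∈ Ω) →
    H (∫ x, f x ∂μ, ∫ x, g x ∂μ) ≤
      ∫ x, essSup (fun y => H (f (a⁻¹ • (x - y)), g (b⁻¹ • y))) volume ∂μ

theorem isBoundedUnder_le_of_abs_le {Y : Type*} {f : Y → ℝ} {C : ℝ} (l : Filter Y)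
    (hf : ∀ y, |f y| ≤ C) : IsBoundedUnder (· ≤ ·) l f :=
  isBoundedUnder_of ⟨C, fun y => (abs_le.1 (hf y)).2⟩

theorem isCoboundedUnder_le_of_abs_le {Y : Type*} {f : Y → ℝ} {C : ℝ} (l : Filter Y) [l.NeBot]
    (hf : ∀ y, |f y| ≤ C) : IsCoboundedUnder (· ≤ ·) l f :=
  IsBoundedUnder.isCoboundedUnder_le
    (isBoundedUnder_of ⟨-C, fun y => (abs_le.1 (hf y)).1⟩)

theorem essSup_mono_of_abs_le {Y : Type*} [MeasurableSpace Y] {ν : Measure Y} [NeZero ν]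
    {f g : Y → ℝ} {C D : ℝ} (hf : ∀ y, |f y| ≤ C) (hg : ∀ y, |g y| ≤ D) (hfg : f ≤ g) :
    essSup f ν ≤ essSup g ν :=
  limsup_le_limsup (Eventually.of_forall hfg)
    (isCoboundedUnder_le_of_abs_le _ hf) (isBoundedUnder_le_of_abs_le _ hg)

theorem essSup_le_iff_of_abs_le {Y : Type*} [MeasurableSpace Y] {ν : Measure Y} [NeZero ν]
    {f : Y → ℝ} {C : ℝ} (hf : ∀ y, |f y| ≤ C) (c : ℝ) :
    essSup f ν ≤ c ↔ ∀ᵐ y ∂ν, f y ≤ c :=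
  ⟨fun h => (ae_le_essSup (isBoundedUnder_le_of_abs_le _ hf)).mono fun _ hy => hy.trans h,
    fun h => limsup_le_of_le (isCoboundedUnder_le_of_abs_le _ hf) h⟩

theorem abs_essSup_le {Y : Type*} [MeasurableSpace Y] {ν : Measure Y} [NeZero ν]
    {f : Y → ℝ} {C : ℝ} (hf : ∀ y, |f y| ≤ C) : |essSup f ν| ≤ C := by
  refine abs_le.2 ⟨?_, ?_⟩
  · obtain ⟨y, hy⟩ := (ae_le_essSup (μ := ν) (isBoundedUnder_le_of_abs_le _ hf)).exists
    exact (abs_le.1 (hf y)).1.trans hy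
  · exact (essSup_le_iff_of_abs_le hf C).2 (Eventually.of_forall fun y => (abs_le.1 (hf y)).2)

theorem measurable_essSup_right {X Y : Type*} [MeasurableSpace X] [MeasurableSpace Y]
    {ν : Measure Y} [SFinite ν] [NeZero ν] {F : X × Y → ℝ} {C : ℝ} (hF : Measurable F)
    (hC : ∀ p, |F p| ≤ C) : Measurable fun x => essSup (fun y => F (x, y)) ν := by
  refine measurable_of_Iic fun c => ?_
  have hset : (fun x => essSup (fun y => F (x, y)) ν) ⁻¹' Set.Iic c =
      {x | ν (Prod.mk x ⁻¹' {p | c < F p}) = 0} := by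
    ext x
    rw [Set.mem_preimage, Set.mem_Iic, essSup_le_iff_of_abs_le (fun y => hC (x, y)), ae_iff]
    simp only [not_le, Set.mem_ofPred_eq, Set.preimage_ofPred_eq]
  rw [hset]
  exact measurable_measure_prodMk_left (measurableSet_lt measurable_const hF)
    (measurableSet_singleton 0)

theorem integrable_essSup_right {X Y : Type*} [MeasurableSpace X] [MeasurableSpace Y]
    {μ : Measure X} [IsFiniteMeasure μ] {ν : Measure Y} [SFinite ν] [NeZero ν]
    {F : X × Y → ℝ} {C : ℝ} (hF : Measurable F) (hC : ∀ p, |F p| ≤ C) :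
    Integrable (fun x => essSup (fun y => F (x, y)) ν) μ :=
  .of_bound (measurable_essSup_right hF hC).aestronglyMeasurable C
    (Eventually.of_forall fun x => abs_essSup_le fun y => hC (x, y))

theorem ContinuousOn.measurable_comp_of_forall_mem {X Z W : Type*} [MeasurableSpace X]
    [TopologicalSpace Z] [MeasurableSpace Z] [OpensMeasurableSpace Z]
    [TopologicalSpace W] [MeasurableSpace W] [BorelSpace W]
    {s : Set Z} {H : Z → W} {φ : X → Z} (hH : ContinuousOn H s) (hφ : Measurable φ)
    (hmem : ∀ x, φ x ∈ s) : Measurable fun x => H (φ x) :=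
  (continuousOn_iff_continuous_domRestrict.1 hH).measurable.comp (hφ.subtype_mk (h := hmem))

theorem integral_essSup_comp_mono {n : ℕ} {a b : ℝ} {Ω : Set (ℝ × ℝ)} (hΩ : IsCompact Ω)
    {μ : Measure (Euc n)} [IsFiniteMeasure μ] {H K : ℝ × ℝ → ℝ}
    (hH : ContinuousOn H Ω) (hK : ContinuousOn K Ω) (hHK : H ≤ K)
    {f g : Euc n → ℝ} (hf : Measurable f) (hg : Measurable g) (hfg : ∀ x y, (f x, g y) ∈ Ω) :
    ∫ x, essSup (fun y => H (f (a⁻¹ • (x - y)), g (b⁻¹ • y))) volume ∂μ ≤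
      ∫ x, essSup (fun y => K (f (a⁻¹ • (x - y)), g (b⁻¹ • y))) volume ∂μ := by
  have hφ : Measurable fun p : Euc n × Euc n => (f (a⁻¹ • (p.1 - p.2)), g (b⁻¹ • p.2)) := by
    fun_prop
  obtain ⟨C, hC⟩ := hΩ.exists_bound_of_continuousOn hH
  obtain ⟨D, hD⟩ := hΩ.exists_bound_of_continuousOn hK
  have hint {L : ℝ × ℝ → ℝ} {M : ℝ} (hL : ContinuousOn L Ω) (hM : ∀ p ∈ Ω, ‖L p‖ ≤ M) :
      Integrable (fun x => essSup (fun y => L (f (a⁻¹ • (x - y)), g (b⁻¹ • y))) volume) μ :=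
    integrable_essSup_right
      (F := fun p : Euc n × Euc n => L (f (a⁻¹ • (p.1 - p.2)), g (b⁻¹ • p.2)))
      (hL.measurable_comp_of_forall_mem hφ fun _ => hfg _ _) fun _ => hM _ (hfg _ _)
  refine integral_mono (hint hH hC) (hint hK hD) fun x => ?_
  exact essSup_mono_of_abs_le (fun y => hC _ (hfg _ _)) (fun y => hD _ (hfg _ _))
    fun y => hHK _

/-- inequality (★) is closed under taking the pointwise maximum. -/
theorem stmt15 (n : ℕ) (a b : ℝ) (ha : 0 < a) (hb : 0 < b)
    (P Q : ℝ × ℝ)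
    (μ : Measure (Euc n)) (hprob : IsProbabilityMeasure μ)
    (H₁ H₂ : ℝ × ℝ → ℝ)
    (hc1 : ContinuousOn H₁ (Set.Icc P Q)) (hc2 : ContinuousOn H₂ (Set.Icc P Q))
    (h1 : StarIneq a b (Set.Icc P Q) H₁ μ) (h2 : StarIneq a b (Set.Icc P Q) H₂ μ) :
    StarIneq a b (Set.Icc P Q) (fun p => max (H₁ p) (H₂ p)) μ := by
  intro f g hf hg hfg
  have hmax : ContinuousOn (fun p => max (H₁ p) (H₂ p)) (Set.Icc P Q) := hc1.sup hc2
  exact max_le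
    ((h1 f g hf hg hfg).trans <| integral_essSup_comp_mono isCompact_Icc hc1 hmax
      (fun _ => le_max_left _ _) hf hg hfg)
    ((h2 f g hf hg hfg).trans <| integral_essSup_comp_mono isCompact_Icc hc2 hmax
      (fun _ => le_max_right _ _) hf hg hfg)

end
end
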